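/- Let P be an n-dimensional hyperbolic simplex with n ≥ 3, equipped with a non-trivial Coxeter decomposition such that every vertex v of P is contained in exactly one tile F_v. Then for every vertex v of P, the tile F_v contains no vertex of P other than v. -/

import Mathlib

noncomputable section

namespace CD

open MeasureTheory Set
open scoped ENNReal

/-! ## Coxeter diagrams, encoded as Coxeter matrices.
A Coxeter diagram on `k` nodes is encoded by its Coxeter matrix
`M : Matrix (Fin k) (Fin k) ℕ`: `M i i = 1`, and for `i ≠ j` the entry `M i j = m`
means that the corresponding facets meet at the dihedral angle `π / m`
(`2` = no edge of the diagram, and `0` encodes the label `∞`, i.e. angle `0`,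
consistently with `π / 0 = 0` in Lean). -/

/-- A Coxeter diagram: a number of nodes together with a Coxeter matrix. -/
def CM : Type := Σ k : ℕ, Matrix (Fin k) (Fin k) ℕ

/-- The Coxeter matrix on `k` nodes with the given list of labelled edges
(`(i, j, m)` is an edge between nodes `i` and `j` with label `m`). -/
def cmOfEdges (k : ℕ) (E : List (ℕ × ℕ × ℕ)) : Matrix (Fin k) (Fin k) ℕ :=
  Matrix.of fun i j =>
    if i = j then 1 else
      match E.find? (fun e => (e.1 == (i : ℕ) && e.2.1 == (j : ℕ)) ||
                              (e.1 == (j : ℕ) && e.2.1 == (i : ℕ))) with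
      | some e => e.2.2
      | none => 2

/-- The Coxeter matrix of type `A_k`. -/
def cmA (k : ℕ) : Matrix (Fin k) (Fin k) ℕ :=
  Matrix.of fun i j =>
    if i = j then 1
    else if (i : ℕ) + 1 = (j : ℕ) ∨ (j : ℕ) + 1 = (i : ℕ) then 3 else 2

/-- The Coxeter matrix of type `D_k`, with the conventions `D_2 = A_1 + A_1` and
`D_3 = A_3`. -/
def cmD (k : ℕ) : Matrix (Fin k) (Fin k) ℕ :=
  Matrix.of fun i j =>
    if i = j then 1
    else if k = 2 then 2
    else if ((i : ℕ) + 1 = (j : ℕ) ∧ (j : ℕ) ≤ k - 2) ∨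
            ((j : ℕ) + 1 = (i : ℕ) ∧ (i : ℕ) ≤ k - 2) ∨
            ((i : ℕ) = k - 3 ∧ (j : ℕ) = k - 1) ∨
            ((j : ℕ) = k - 3 ∧ (i : ℕ) = k - 1)
      then 3 else 2

/-- Direct sum (disjoint union) of two Coxeter matrices. -/
def cmSum {a b : ℕ} (M : Matrix (Fin a) (Fin a) ℕ) (N : Matrix (Fin b) (Fin b) ℕ) :
    Matrix (Fin (a + b)) (Fin (a + b)) ℕ :=
  Matrix.of fun i j =>
    if hi : (i : ℕ) < a then
      if hj : (j : ℕ) < a then M ⟨i, hi⟩ ⟨j, hj⟩ else 2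
    else
      if _hj : (j : ℕ) < a then 2
      else N ⟨(i : ℕ) - a, by have := i.isLt; omega⟩ ⟨(j : ℕ) - a, by have := j.isLt; omega⟩

def cmAdd (x y : CM) : CM := ⟨x.1 + y.1, cmSum x.2 y.2⟩

def cmNil : CM := ⟨0, Matrix.of fun _ _ => 1⟩

/-- Disjoint union of a list of Coxeter diagrams. -/
def cmList (l : List CM) : CM := l.foldr cmAdd cmNil

def cA (k : ℕ) : CM := ⟨k, cmA k⟩
def cD (k : ℕ) : CM := ⟨k, cmD k⟩
def cE6 : CM := ⟨6, cmOfEdges 6 [(0,1,3),(1,2,3),(2,3,3),(3,4,3),(2,5,3)]⟩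
def cE7 : CM := ⟨7, cmOfEdges 7 [(0,1,3),(1,2,3),(2,3,3),(3,4,3),(4,5,3),(2,6,3)]⟩
def cE8 : CM := ⟨8, cmOfEdges 8 [(0,1,3),(1,2,3),(2,3,3),(3,4,3),(4,5,3),(5,6,3),(2,7,3)]⟩
def cF4 : CM := ⟨4, cmOfEdges 4 [(0,1,3),(1,2,4),(2,3,3)]⟩
def cH3 : CM := ⟨3, cmOfEdges 3 [(0,1,5),(1,2,3)]⟩
def cH4 : CM := ⟨4, cmOfEdges 4 [(0,1,5),(1,2,3),(2,3,3)]⟩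
/-- `G₂^{(5)} = I₂(5)`. -/
def cG25 : CM := ⟨2, cmOfEdges 2 [(0,1,5)]⟩

/-- The affine (Euclidean) Coxeter matrix `Ã₃` (a 4-cycle). -/
def cmA3t : Matrix (Fin 4) (Fin 4) ℕ := cmOfEdges 4 [(0,1,3),(1,2,3),(2,3,3),(0,3,3)]
/-- The affine Coxeter matrix `D̃₄`. -/
def cmD4t : Matrix (Fin 5) (Fin 5) ℕ := cmOfEdges 5 [(0,1,3),(0,2,3),(0,3,3),(0,4,3)]
/-- The affine Coxeter matrix `C̃₄`. -/
def cmC4t : Matrix (Fin 5) (Fin 5) ℕ := cmOfEdges 5 [(0,1,4),(1,2,3),(2,3,3),(3,4,4)]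
/-- The affine Coxeter matrix `F̃₄`. -/
def cmF4t : Matrix (Fin 5) (Fin 5) ℕ := cmOfEdges 5 [(0,1,3),(1,2,3),(2,3,4),(3,4,3)]
/-- The affine Coxeter matrix `C̃₂` (the Euclidean (2,4,4)-triangle). -/
def cmC2t : Matrix (Fin 3) (Fin 3) ℕ := cmOfEdges 3 [(0,1,4),(1,2,4)]
/-- The affine Coxeter matrix `G̃₂` (the Euclidean (2,3,6)-triangle). -/
def cmG2t : Matrix (Fin 3) (Fin 3) ℕ := cmOfEdges 3 [(0,1,6),(1,2,3)]

/-- Connectedness of a Coxeter diagram. -/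
def cmConnected (c : CM) : Prop :=
  ∀ i j : Fin c.1, Relation.ReflTransGen (fun a b => 3 ≤ c.2 a b ∨ c.2 a b = 0) i j

/-! ## Hyperbolic space `H^n`: the hyperboloid model. -/

/-- The Minkowski bilinear form of signature `(n,1)` on `ℝ^{n+1}`. -/
def mink (n : ℕ) (x y : EuclideanSpace ℝ (Fin (n + 1))) : ℝ :=
  -(x 0 * y 0) + ∑ i : Fin n, x i.succ * y i.succ

/-- The hyperboloid model of hyperbolic `n`-space:
`{x ∈ ℝ^{n+1} : ⟨x,x⟩ = -1, x₀ > 0}`. -/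
def hypSet (n : ℕ) : Set (EuclideanSpace ℝ (Fin (n + 1))) :=
  {x | mink n x x = -1 ∧ 0 < x 0}

/-- The closed half-space of `H^n` with (spacelike unit) outward normal `v`. -/
def hHalf (n : ℕ) (v : EuclideanSpace ℝ (Fin (n + 1))) : Set ↥(hypSet n) :=
  {x | mink n v x.val ≤ 0}

/-- The hyperplane of `H^n` with (spacelike unit) normal `v`. -/
def hWall (n : ℕ) (v : EuclideanSpace ℝ (Fin (n + 1))) : Set ↥(hypSet n) :=
  {x | mink n v x.val = 0}

/-- Projection of the hyperboloid to the Beltrami–Klein ball. -/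
def klein (n : ℕ) (x : ↥(hypSet n)) : Fin n → ℝ := fun i => x.val i.succ / x.val 0

/-- The hyperbolic (Riemannian) volume of a subset of `H^n`, computed in the
Beltrami–Klein model, where the volume element is `(1-|y|²)^{-(n+1)/2} dy`. -/
def hVol (n : ℕ) (S : Set ↥(hypSet n)) : ℝ≥0∞ :=
  ∫⁻ y in klein n '' S,
    ENNReal.ofReal ((1 - ∑ i, y i ^ 2) ^ (-((n : ℝ) + 1) / 2)) ∂(volume)

/-- An isometry of `H^n`: a bijection preserving the Minkowski product
(equivalently, the hyperbolic distance `arcosh(-⟨x,y⟩)`). -/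
def hIsIsom (n : ℕ) (g : ↥(hypSet n) → ↥(hypSet n)) : Prop :=
  Function.Bijective g ∧ ∀ x y, mink n (g x).val (g y).val = mink n x.val y.val

/-- Two subsets of `H^n` are congruent if an isometry carries one onto the other. -/
def hCongr (n : ℕ) (A B : Set ↥(hypSet n)) : Prop :=
  ∃ g, hIsIsom n g ∧ g '' A = B

/-- The ambient reflection of `ℝ^{n+1}` in the hyperplane with spacelike unit normal `v`. -/
def hReflect (n : ℕ) (v x : EuclideanSpace ℝ (Fin (n + 1))) :
    EuclideanSpace ℝ (Fin (n + 1)) :=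
  x - (2 * mink n v x) • v

/-- `S` is a facet ((n-1)-dimensional face) of the polyhedron `P ⊆ H^n`:
`S = P ∩ Π` for a supporting hyperplane `Π` of `P`, and `S` lies in no other
hyperplane (so it is genuinely `(n-1)`-dimensional). -/
def hIsFacet (n : ℕ) (P S : Set ↥(hypSet n)) : Prop :=
  S.Nonempty ∧ ∃ v, mink n v v = 1 ∧ P ⊆ hHalf n v ∧ S = P ∩ hWall n v ∧
    ∀ u, mink n u u = 1 → S ⊆ hWall n u → hWall n u = hWall n v

/-- A convex polyhedron in `H^n`: an intersection of finitely many closed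
half-spaces with nonempty interior and finite volume. -/
def hIsPoly (n : ℕ) (P : Set ↥(hypSet n)) : Prop :=
  ∃ (k : ℕ) (v : Fin k → EuclideanSpace ℝ (Fin (n + 1))),
    (∀ i, mink n (v i) (v i) = 1) ∧ P = ⋂ i, hHalf n (v i) ∧
    (interior P).Nonempty ∧ hVol n P < ⊤

/-- A Coxeter polyhedron in `H^n`: a convex polyhedron all of whose dihedral
angles are of the form `π/k`, `k ≥ 2` (the dihedral angle along a ridge with
outward unit normals `u, v` is `π/k` iff `⟨u,v⟩ = -cos (π/k)`). -/
def hIsCoxPoly (n : ℕ) (P : Set ↥(hypSet n)) : Prop :=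
  ∃ (k : ℕ) (v : Fin k → EuclideanSpace ℝ (Fin (n + 1))),
    (∀ i, mink n (v i) (v i) = 1) ∧ P = ⋂ i, hHalf n (v i) ∧
    (interior P).Nonempty ∧ hVol n P < ⊤ ∧
    ∀ i j, hWall n (v i) ≠ hWall n (v j) →
      (∃ x ∈ P, x ∈ hWall n (v i) ∩ hWall n (v j)) →
      ∃ m : ℕ, 2 ≤ m ∧ mink n (v i) (v j) = -Real.cos (Real.pi / (m : ℝ))

/-- A simplex in `H^n` (possibly with ideal vertices): a convex polyhedron with
exactly `n+1` facets. -/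
def hIsSimplex (n : ℕ) (P : Set ↥(hypSet n)) : Prop :=
  hIsPoly n P ∧ {S | hIsFacet n P S}.ncard = n + 1

/-- A Coxeter decomposition of `P ⊆ H^n`: a decomposition of `P` into finitely
many tiles with pairwise disjoint interiors, each tile a Coxeter polyhedron,
such that any two tiles having a common facet are symmetric with respect to
(the hyperplane of) this facet. -/
def hIsCoxDecomp (n : ℕ) (P : Set ↥(hypSet n)) (𝒯 : Set (Set ↥(hypSet n))) : Prop :=
  𝒯.Finite ∧ 𝒯.Nonempty ∧ (∀ T ∈ 𝒯, hIsCoxPoly n T) ∧ ⋃₀ 𝒯 = P ∧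
  (∀ T₁ ∈ 𝒯, ∀ T₂ ∈ 𝒯, T₁ ≠ T₂ → interior T₁ ∩ interior T₂ = ∅) ∧
  (∀ T₁ ∈ 𝒯, ∀ T₂ ∈ 𝒯, T₁ ≠ T₂ → ∀ S, hIsFacet n T₁ S → hIsFacet n T₂ S →
    ∃ v, mink n v v = 1 ∧ S ⊆ hWall n v ∧
      T₂ = {y | ∃ x ∈ T₁, (y : EuclideanSpace ℝ (Fin (n + 1))) = hReflect n v x.val})

/-- A hyperplane (with unit normal `v`) is a mirror of the decomposition `𝒯` of `P`
if it contains a facet of some tile but no facet of `P`. -/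
def hIsMirror (n : ℕ) (P : Set ↥(hypSet n)) (𝒯 : Set (Set ↥(hypSet n)))
    (v : EuclideanSpace ℝ (Fin (n + 1))) : Prop :=
  mink n v v = 1 ∧ (∃ T ∈ 𝒯, ∃ S, hIsFacet n T S ∧ S ⊆ hWall n v) ∧
  ¬∃ S, hIsFacet n P S ∧ S ⊆ hWall n v

/-- The decomposition `𝒯` of `P` is of the second type: every dihedral angle of `P`
is fundamental, i.e. no mirror contains the intersection of two facets of `P`. -/
def hSecondType (n : ℕ) (P : Set ↥(hypSet n)) (𝒯 : Set (Set ↥(hypSet n))) : Prop :=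
  ∀ α β, hIsFacet n P α → hIsFacet n P β → α ≠ β → (α ∩ β).Nonempty →
    ¬∃ v, hIsMirror n P 𝒯 v ∧ α ∩ β ⊆ hWall n v

/-- Decompositions obtainable by the inductive algorithm (decompositions of the
first type), with fundamental simplex `F`: start from (isometric copies of) `F`,
and repeatedly glue two previously obtained decomposed simplices along a common
facet so that the union is again a simplex and the union of the two
decompositions is a Coxeter decomposition of it. -/
inductive hFirstType (n : ℕ) (F : Set ↥(hypSet n)) :
    Set ↥(hypSet n) → Set (Set ↥(hypSet n)) → Prop
  | base (P : Set ↥(hypSet n)) : hCongr n F P → hIsSimplex n P → hFirstType n F P {P}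
  | congr (P : Set ↥(hypSet n)) (𝒯 : Set (Set ↥(hypSet n)))
      (g : ↥(hypSet n) → ↥(hypSet n)) :
      hIsIsom n g → hFirstType n F P 𝒯 → hFirstType n F (g '' P) ((fun T => g '' T) '' 𝒯)
  | glue (P₁ P₂ : Set ↥(hypSet n)) (𝒯₁ 𝒯₂ : Set (Set ↥(hypSet n))) (S : Set ↥(hypSet n)) :
      hFirstType n F P₁ 𝒯₁ → hFirstType n F P₂ 𝒯₂ →
      hIsFacet n P₁ S → hIsFacet n P₂ S →
      interior P₁ ∩ interior P₂ = ∅ →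
      hIsSimplex n (P₁ ∪ P₂) →
      hIsCoxDecomp n (P₁ ∪ P₂) (𝒯₁ ∪ 𝒯₂) →
      hFirstType n F (P₁ ∪ P₂) (𝒯₁ ∪ 𝒯₂)

/-- A vertex of the simplex `P ⊆ H^n`: a point of `P` lying on at least `n` facets. -/
def hIsVertex (n : ℕ) (P : Set ↥(hypSet n)) (x : ↥(hypSet n)) : Prop :=
  x ∈ P ∧ n ≤ {S | hIsFacet n P S ∧ x ∈ S}.ncard

/-- The cone over `S ⊆ H^n` in `ℝ^{n+1}`. -/
def hCone (n : ℕ) (S : Set ↥(hypSet n)) : Set (EuclideanSpace ℝ (Fin (n + 1))) :=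
  {y | ∃ x ∈ S, ∃ t : ℝ, 0 < t ∧ y = t • (x : EuclideanSpace ℝ (Fin (n + 1)))}

/-- The ideal vertices of `P ⊆ H^n`: lightlike directions (normalized by `w₀ = 1`)
in the closure of the cone over `P`. -/
def hIdealVerts (n : ℕ) (P : Set ↥(hypSet n)) : Set (EuclideanSpace ℝ (Fin (n + 1))) :=
  {w | mink n w w = 0 ∧ w 0 = 1 ∧ w ∈ closure (hCone n P)}

/-- The ideal vertex `w` of `P` has horospherical link of the Euclidean type given
by the (affine) Coxeter matrix `M`: the facets of `P` incident to `w` can be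
indexed so that their unit normals have Gram matrix `-cos (π / M i j)`. -/
def hIdealLink (n : ℕ) (P : Set ↥(hypSet n)) (w : EuclideanSpace ℝ (Fin (n + 1)))
    {k : ℕ} (M : Matrix (Fin k) (Fin k) ℕ) : Prop :=
  ∃ e : Fin k → EuclideanSpace ℝ (Fin (n + 1)),
    (∀ i, mink n (e i) (e i) = 1) ∧
    (∀ i, mink n (e i) w = 0) ∧
    (∀ i j, i ≠ j → mink n (e i) (e j) = -Real.cos (Real.pi / (M i j : ℝ))) ∧
    (∀ i j, i ≠ j → hWall n (e i) ≠ hWall n (e j)) ∧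
    {S | hIsFacet n P S ∧ w ∈ closure (hCone n S)} =
      Set.range fun i => P ∩ hWall n (e i)

/-- The number of tiles of `𝒯` incident to the ideal point `w`. -/
def hTilesAt (n : ℕ) (𝒯 : Set (Set ↥(hypSet n)))
    (w : EuclideanSpace ℝ (Fin (n + 1))) : ℕ :=
  {T | T ∈ 𝒯 ∧ w ∈ closure (hCone n T)}.ncard

/-- An occurrence, in the Coxeter diagram of `P`, of a subdiagram of type `M`:
a set `𝒜` of `k` facets of `P` whose unit normals have Gram matrix
`-cos (π / M i j)`. -/
def hSubOcc (n : ℕ) (P : Set ↥(hypSet n)) {k : ℕ} (M : Matrix (Fin k) (Fin k) ℕ)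
    (𝒜 : Set (Set ↥(hypSet n))) : Prop :=
  ∃ e : Fin k → EuclideanSpace ℝ (Fin (n + 1)),
    (∀ i, mink n (e i) (e i) = 1) ∧
    (∀ i j, i ≠ j → mink n (e i) (e j) = -Real.cos (Real.pi / (M i j : ℝ))) ∧
    (∀ i, hIsFacet n P (P ∩ hWall n (e i))) ∧
    𝒜 = Set.range (fun i => P ∩ hWall n (e i)) ∧ 𝒜.ncard = k

/-- The polyhedron `P ⊆ H^n` is a Coxeter simplex with Coxeter diagram (matrix) `M`. -/
def hOfType (n : ℕ) (P : Set ↥(hypSet n)) {k : ℕ} (M : Matrix (Fin k) (Fin k) ℕ) : Prop :=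
  (∀ i, M i i = 1) ∧ (∀ i j, M i j = M j i) ∧
  ∃ e : Fin k → EuclideanSpace ℝ (Fin (n + 1)),
    (∀ i, mink n (e i) (e i) = 1) ∧
    (∀ i j, i ≠ j → mink n (e i) (e j) = -Real.cos (Real.pi / (M i j : ℝ))) ∧
    P = ⋂ i, hHalf n (e i) ∧ (∀ i, hIsFacet n P (P ∩ hWall n (e i)))

/-- Equivalence of two decompositions of the same polyhedron `P`, up to an
isometry preserving `P`. -/
def hDecompEquiv (n : ℕ) (P : Set ↥(hypSet n)) (𝒯₁ 𝒯₂ : Set (Set ↥(hypSet n))) : Prop :=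
  ∃ g, hIsIsom n g ∧ g '' P = P ∧ (fun T => g '' T) '' 𝒯₁ = 𝒯₂

/-- A Coxeter decomposition of the second type of `P` with fundamental simplex `F`. -/
def hSTDecomp (n : ℕ) (P F : Set ↥(hypSet n)) (𝒯 : Set (Set ↥(hypSet n))) : Prop :=
  hIsCoxDecomp n P 𝒯 ∧ (∀ T ∈ 𝒯, hCongr n F T) ∧ hSecondType n P 𝒯

def hCoxSimplex (n : ℕ) (P : Set ↥(hypSet n)) : Prop := hIsCoxPoly n P ∧ hIsSimplex n P

/-! ## The sphere `S^n ⊂ ℝ^{n+1}`. -/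

/-- The Euclidean dot product on `ℝ^{n+1}`. -/
def sdot (n : ℕ) (x y : EuclideanSpace ℝ (Fin (n + 1))) : ℝ := ∑ i, x i * y i

/-- The unit sphere `S^n ⊂ ℝ^{n+1}`. -/
def sSet (n : ℕ) : Set (EuclideanSpace ℝ (Fin (n + 1))) := {x | sdot n x x = 1}

/-- The closed hemisphere of `S^n` with (unit) outward normal `v`. -/
def sHalf (n : ℕ) (v : EuclideanSpace ℝ (Fin (n + 1))) : Set ↥(sSet n) :=
  {x | sdot n v x.val ≤ 0}

/-- The great hypersphere of `S^n` with (unit) normal `v`. -/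
def sWall (n : ℕ) (v : EuclideanSpace ℝ (Fin (n + 1))) : Set ↥(sSet n) :=
  {x | sdot n v x.val = 0}

/-- The spherical (Riemannian) volume of `S ⊆ S^n`: `(n+1)` times the Lebesgue
measure of the cone over `S` truncated at radius `1`. -/
def sVol (n : ℕ) (S : Set ↥(sSet n)) : ℝ≥0∞ :=
  ((n : ℝ≥0∞) + 1) *
    volume {y : Fin (n + 1) → ℝ | ∃ x ∈ S, ∃ t : ℝ, 0 < t ∧ t ≤ 1 ∧
      y = fun i => t * (x : EuclideanSpace ℝ (Fin (n + 1))) i}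

/-- An isometry of `S^n`: a bijection preserving the dot product (equivalently,
the spherical distance). -/
def sIsIsom (n : ℕ) (g : ↥(sSet n) → ↥(sSet n)) : Prop :=
  Function.Bijective g ∧ ∀ x y, sdot n (g x).val (g y).val = sdot n x.val y.val

def sCongr (n : ℕ) (A B : Set ↥(sSet n)) : Prop := ∃ g, sIsIsom n g ∧ g '' A = B

/-- The ambient reflection of `ℝ^{n+1}` in the hyperplane with unit normal `v`. -/
def sReflect (n : ℕ) (v x : EuclideanSpace ℝ (Fin (n + 1))) :
    EuclideanSpace ℝ (Fin (n + 1)) :=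
  x - (2 * sdot n v x) • v

/-- `S` is a facet of the spherical polyhedron `P`. -/
def sIsFacet (n : ℕ) (P S : Set ↥(sSet n)) : Prop :=
  S.Nonempty ∧ ∃ v, sdot n v v = 1 ∧ P ⊆ sHalf n v ∧ S = P ∩ sWall n v ∧
    ∀ u, sdot n u u = 1 → S ⊆ sWall n u → sWall n u = sWall n v

/-- A convex polyhedron in `S^n`. -/
def sIsPoly (n : ℕ) (P : Set ↥(sSet n)) : Prop :=
  ∃ (k : ℕ) (v : Fin k → EuclideanSpace ℝ (Fin (n + 1))),
    (∀ i, sdot n (v i) (v i) = 1) ∧ P = ⋂ i, sHalf n (v i) ∧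
    (interior P).Nonempty ∧ sVol n P < ⊤

/-- A Coxeter polyhedron in `S^n`. -/
def sIsCoxPoly (n : ℕ) (P : Set ↥(sSet n)) : Prop :=
  ∃ (k : ℕ) (v : Fin k → EuclideanSpace ℝ (Fin (n + 1))),
    (∀ i, sdot n (v i) (v i) = 1) ∧ P = ⋂ i, sHalf n (v i) ∧
    (interior P).Nonempty ∧ sVol n P < ⊤ ∧
    ∀ i j, sWall n (v i) ≠ sWall n (v j) →
      (∃ x ∈ P, x ∈ sWall n (v i) ∩ sWall n (v j)) →
      ∃ m : ℕ, 2 ≤ m ∧ sdot n (v i) (v j) = -Real.cos (Real.pi / (m : ℝ))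

/-- A spherical simplex in `S^n`: the intersection of `S^n` with a simplicial cone,
i.e. a convex spherical polyhedron with exactly `n+1` facets. -/
def sIsSimplex (n : ℕ) (P : Set ↥(sSet n)) : Prop :=
  sIsPoly n P ∧ {S | sIsFacet n P S}.ncard = n + 1

/-- A Coxeter decomposition of `P ⊆ S^n`. -/
def sIsCoxDecomp (n : ℕ) (P : Set ↥(sSet n)) (𝒯 : Set (Set ↥(sSet n))) : Prop :=
  𝒯.Finite ∧ 𝒯.Nonempty ∧ (∀ T ∈ 𝒯, sIsCoxPoly n T) ∧ ⋃₀ 𝒯 = P ∧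
  (∀ T₁ ∈ 𝒯, ∀ T₂ ∈ 𝒯, T₁ ≠ T₂ → interior T₁ ∩ interior T₂ = ∅) ∧
  (∀ T₁ ∈ 𝒯, ∀ T₂ ∈ 𝒯, T₁ ≠ T₂ → ∀ S, sIsFacet n T₁ S → sIsFacet n T₂ S →
    ∃ v, sdot n v v = 1 ∧ S ⊆ sWall n v ∧
      T₂ = {y | ∃ x ∈ T₁, (y : EuclideanSpace ℝ (Fin (n + 1))) = sReflect n v x.val})

/-- Mirrors of a spherical Coxeter decomposition. -/
def sIsMirror (n : ℕ) (P : Set ↥(sSet n)) (𝒯 : Set (Set ↥(sSet n)))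
    (v : EuclideanSpace ℝ (Fin (n + 1))) : Prop :=
  sdot n v v = 1 ∧ (∃ T ∈ 𝒯, ∃ S, sIsFacet n T S ∧ S ⊆ sWall n v) ∧
  ¬∃ S, sIsFacet n P S ∧ S ⊆ sWall n v

/-- Second type: every dihedral angle of `P` is fundamental. -/
def sSecondType (n : ℕ) (P : Set ↥(sSet n)) (𝒯 : Set (Set ↥(sSet n))) : Prop :=
  ∀ α β, sIsFacet n P α → sIsFacet n P β → α ≠ β → (α ∩ β).Nonempty →
    ¬∃ v, sIsMirror n P 𝒯 v ∧ α ∩ β ⊆ sWall n v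

/-- `P ⊆ S^n` is a Coxeter simplex with Coxeter diagram (matrix) `M`. -/
def sOfType (n : ℕ) (P : Set ↥(sSet n)) {k : ℕ} (M : Matrix (Fin k) (Fin k) ℕ) : Prop :=
  (∀ i, M i i = 1) ∧ (∀ i j, M i j = M j i) ∧
  ∃ e : Fin k → EuclideanSpace ℝ (Fin (n + 1)),
    (∀ i, sdot n (e i) (e i) = 1) ∧
    (∀ i j, i ≠ j → sdot n (e i) (e j) = -Real.cos (Real.pi / (M i j : ℝ))) ∧
    P = ⋂ i, sHalf n (e i) ∧ (∀ i, sIsFacet n P (P ∩ sWall n (e i)))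

/-- `P ⊆ S^n` is a Coxeter simplex of the type given by the diagram `c`. -/
def sOfTypeCM (n : ℕ) (P : Set ↥(sSet n)) (c : CM) : Prop := sOfType n P c.2

/-! ## Euclidean space `E^n`. -/

/-- The dot product on `E^n`. -/
def edot (n : ℕ) (x y : EuclideanSpace ℝ (Fin n)) : ℝ := ∑ i, x i * y i

/-- The closed affine half-space `{x : ⟨v,x⟩ ≤ c}` of `E^n`. -/
def eHalf (n : ℕ) (v : EuclideanSpace ℝ (Fin n)) (c : ℝ) : Set (EuclideanSpace ℝ (Fin n)) :=
  {x | edot n v x ≤ c}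

/-- The affine hyperplane `{x : ⟨v,x⟩ = c}` of `E^n`. -/
def eWall (n : ℕ) (v : EuclideanSpace ℝ (Fin n)) (c : ℝ) : Set (EuclideanSpace ℝ (Fin n)) :=
  {x | edot n v x = c}

/-- Reflection of `E^n` in the affine hyperplane `{x : ⟨v,x⟩ = c}` (`v` a unit vector). -/
def eReflect (n : ℕ) (v : EuclideanSpace ℝ (Fin n)) (c : ℝ) (x : EuclideanSpace ℝ (Fin n)) :
    EuclideanSpace ℝ (Fin n) :=
  x - (2 * (edot n v x - c)) • v

/-- An isometry of `E^n`. -/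
def eIsIsom (n : ℕ) (g : EuclideanSpace ℝ (Fin n) → EuclideanSpace ℝ (Fin n)) : Prop :=
  Function.Bijective g ∧ ∀ x y, dist (g x) (g y) = dist x y

def eCongr (n : ℕ) (A B : Set (EuclideanSpace ℝ (Fin n))) : Prop :=
  ∃ g, eIsIsom n g ∧ g '' A = B

/-- A similarity transformation of `E^n` carries `A` onto `B`. -/
def eSimilar (n : ℕ) (A B : Set (EuclideanSpace ℝ (Fin n))) : Prop :=
  ∃ (f : EuclideanSpace ℝ (Fin n) → EuclideanSpace ℝ (Fin n)) (r : ℝ), 0 < r ∧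
    Function.Surjective f ∧ (∀ x y, dist (f x) (f y) = r * dist x y) ∧ f '' A = B

/-- `S` is a facet of the Euclidean polyhedron `P`. -/
def eIsFacet (n : ℕ) (P S : Set (EuclideanSpace ℝ (Fin n))) : Prop :=
  S.Nonempty ∧ ∃ v c, edot n v v = 1 ∧ P ⊆ eHalf n v c ∧ S = P ∩ eWall n v c ∧
    ∀ u d, edot n u u = 1 → S ⊆ eWall n u d → eWall n u d = eWall n v c

/-- A convex polyhedron in `E^n`. -/
def eIsPoly (n : ℕ) (P : Set (EuclideanSpace ℝ (Fin n))) : Prop :=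
  ∃ (k : ℕ) (v : Fin k → EuclideanSpace ℝ (Fin n)) (c : Fin k → ℝ),
    (∀ i, edot n (v i) (v i) = 1) ∧ P = ⋂ i, eHalf n (v i) (c i) ∧
    (interior P).Nonempty ∧ volume P < ⊤

/-- A Coxeter polyhedron in `E^n`. -/
def eIsCoxPoly (n : ℕ) (P : Set (EuclideanSpace ℝ (Fin n))) : Prop :=
  ∃ (k : ℕ) (v : Fin k → EuclideanSpace ℝ (Fin n)) (c : Fin k → ℝ),
    (∀ i, edot n (v i) (v i) = 1) ∧ P = ⋂ i, eHalf n (v i) (c i) ∧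
    (interior P).Nonempty ∧ volume P < ⊤ ∧
    ∀ i j, eWall n (v i) (c i) ≠ eWall n (v j) (c j) →
      (∃ x ∈ P, x ∈ eWall n (v i) (c i) ∩ eWall n (v j) (c j)) →
      ∃ m : ℕ, 2 ≤ m ∧ edot n (v i) (v j) = -Real.cos (Real.pi / (m : ℝ))

/-- A simplex in `E^n`: a convex polyhedron with exactly `n+1` facets. -/
def eIsSimplex (n : ℕ) (P : Set (EuclideanSpace ℝ (Fin n))) : Prop :=
  eIsPoly n P ∧ {S | eIsFacet n P S}.ncard = n + 1

/-- A Coxeter decomposition of `P ⊆ E^n`. -/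
def eIsCoxDecomp (n : ℕ) (P : Set (EuclideanSpace ℝ (Fin n)))
    (𝒯 : Set (Set (EuclideanSpace ℝ (Fin n)))) : Prop :=
  𝒯.Finite ∧ 𝒯.Nonempty ∧ (∀ T ∈ 𝒯, eIsCoxPoly n T) ∧ ⋃₀ 𝒯 = P ∧
  (∀ T₁ ∈ 𝒯, ∀ T₂ ∈ 𝒯, T₁ ≠ T₂ → interior T₁ ∩ interior T₂ = ∅) ∧
  (∀ T₁ ∈ 𝒯, ∀ T₂ ∈ 𝒯, T₁ ≠ T₂ → ∀ S, eIsFacet n T₁ S → eIsFacet n T₂ S →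
    ∃ v c, edot n v v = 1 ∧ S ⊆ eWall n v c ∧ T₂ = eReflect n v c '' T₁)

/-- Mirrors of a Euclidean Coxeter decomposition. -/
def eIsMirror (n : ℕ) (P : Set (EuclideanSpace ℝ (Fin n)))
    (𝒯 : Set (Set (EuclideanSpace ℝ (Fin n))))
    (v : EuclideanSpace ℝ (Fin n)) (c : ℝ) : Prop :=
  edot n v v = 1 ∧ (∃ T ∈ 𝒯, ∃ S, eIsFacet n T S ∧ S ⊆ eWall n v c) ∧
  ¬∃ S, eIsFacet n P S ∧ S ⊆ eWall n v c

/-- Second type: every dihedral angle of `P` is fundamental. -/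
def eSecondType (n : ℕ) (P : Set (EuclideanSpace ℝ (Fin n)))
    (𝒯 : Set (Set (EuclideanSpace ℝ (Fin n)))) : Prop :=
  ∀ α β, eIsFacet n P α → eIsFacet n P β → α ≠ β → (α ∩ β).Nonempty →
    ¬∃ v c, eIsMirror n P 𝒯 v c ∧ α ∩ β ⊆ eWall n v c

/-- `P ⊆ E^n` is a Coxeter simplex with Coxeter diagram (matrix) `M`. -/
def eOfType (n : ℕ) (P : Set (EuclideanSpace ℝ (Fin n))) {k : ℕ}
    (M : Matrix (Fin k) (Fin k) ℕ) : Prop :=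
  (∀ i, M i i = 1) ∧ (∀ i j, M i j = M j i) ∧
  ∃ (e : Fin k → EuclideanSpace ℝ (Fin n)) (c : Fin k → ℝ),
    (∀ i, edot n (e i) (e i) = 1) ∧
    (∀ i j, i ≠ j → edot n (e i) (e j) = -Real.cos (Real.pi / (M i j : ℝ))) ∧
    P = ⋂ i, eHalf n (e i) (c i) ∧ (∀ i, eIsFacet n P (P ∩ eWall n (e i) (c i)))

/-! ## The particular non-compact hyperbolic Coxeter simplices occurring in the
classification, identified by the structural data given in the paper
(dimension, compactness, number and types of ideal vertices, subdiagrams of the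
Coxeter diagram, and (relative) volumes). -/

/-- The Coxeter simplex `H₃⁴ ⊂ H⁴`: non-compact, with exactly one ideal vertex,
whose horospherical link is of Euclidean type `Ã₃`; volume `≈ 0.01370778`. -/
def IsH34 {n : ℕ} (P : Set ↥(hypSet n)) : Prop :=
  n = 4 ∧ hCoxSimplex n P ∧ ¬IsCompact P ∧ (hIdealVerts n P).ncard = 1 ∧
  (∀ w ∈ hIdealVerts n P, hIdealLink n P w cmA3t) ∧
  hVol n P ∈ Set.Ioo (ENNReal.ofReal 0.0137077) (ENNReal.ofReal 0.0137078)

/-- The Coxeter simplex `H₉⁴ ⊂ H⁴`: non-compact, with exactly three ideal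
vertices, each of type `Ã₃`, of volume exactly `10` times that of `H₃⁴`. -/
def IsH94 {n : ℕ} (P : Set ↥(hypSet n)) : Prop :=
  n = 4 ∧ hCoxSimplex n P ∧ ¬IsCompact P ∧ (hIdealVerts n P).ncard = 3 ∧
  (∀ w ∈ hIdealVerts n P, hIdealLink n P w cmA3t) ∧
  ∀ F : Set ↥(hypSet n), IsH34 F → hVol n P = 10 * hVol n F

/-- The Coxeter simplex `H₄⁵ ⊂ H⁵`: non-compact, of volume `≈ 0.0010956247`. -/
def IsH45 {n : ℕ} (P : Set ↥(hypSet n)) : Prop :=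
  n = 5 ∧ hCoxSimplex n P ∧ ¬IsCompact P ∧
  hVol n P ∈ Set.Ioo (ENNReal.ofReal 0.0010956) (ENNReal.ofReal 0.0010957)

/-- The Coxeter simplex `H₅⁵ ⊂ H⁵`: non-compact, of volume `≈ 0.0018260413`,
whose Coxeter diagram contains exactly one parabolic subdiagram of type `C̃₄`
and exactly one of type `F̃₄`. -/
def IsH55 {n : ℕ} (P : Set ↥(hypSet n)) : Prop :=
  n = 5 ∧ hCoxSimplex n P ∧ ¬IsCompact P ∧
  {𝒜 | hSubOcc n P cmC4t 𝒜}.ncard = 1 ∧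
  {𝒜 | hSubOcc n P cmF4t 𝒜}.ncard = 1 ∧
  hVol n P ∈ Set.Ioo (ENNReal.ofReal 0.0018260) (ENNReal.ofReal 0.0018261)

/-- The Coxeter simplex `H₇⁵ ⊂ H⁵`: non-compact, of volume `≈ 0.0036520826`,
with three ideal vertices, whose Coxeter diagram contains no parabolic
subdiagram of type `D̃₄`. -/
def IsH75 {n : ℕ} (P : Set ↥(hypSet n)) : Prop :=
  n = 5 ∧ hCoxSimplex n P ∧ ¬IsCompact P ∧ (hIdealVerts n P).ncard = 3 ∧
  (¬∃ 𝒜, hSubOcc n P cmD4t 𝒜) ∧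
  hVol n P ∈ Set.Ioo (ENNReal.ofReal 0.0036520) (ENNReal.ofReal 0.0036521)

/-- The Coxeter simplex `H₁₁⁵ ⊂ H⁵`: non-compact, with five ideal vertices, one
of which has horospherical link of Euclidean type `D̃₄`; its volume is exactly
`20` times that of `H₄⁵` (and exactly `6` times that of `H₇⁵`). -/
def IsH115 {n : ℕ} (P : Set ↥(hypSet n)) : Prop :=
  n = 5 ∧ hCoxSimplex n P ∧ ¬IsCompact P ∧ (hIdealVerts n P).ncard = 5 ∧
  (∃ w ∈ hIdealVerts n P, hIdealLink n P w cmD4t) ∧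
  (∀ F : Set ↥(hypSet n), IsH45 F → hVol n P = 20 * hVol n F) ∧
  (∀ F : Set ↥(hypSet n), IsH75 F → hVol n P = 6 * hVol n F)

/-- The Coxeter simplex `H₁₂⁵ ⊂ H⁵`: non-compact, whose Coxeter diagram contains
exactly two parabolic subdiagrams of type `C̃₄` and exactly four of type `F̃₄`;
its volume is exactly `16` times that of `H₅⁵`. -/
def IsH125 {n : ℕ} (P : Set ↥(hypSet n)) : Prop :=
  n = 5 ∧ hCoxSimplex n P ∧ ¬IsCompact P ∧
  {𝒜 | hSubOcc n P cmC4t 𝒜}.ncard = 2 ∧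
  {𝒜 | hSubOcc n P cmF4t 𝒜}.ncard = 4 ∧
  ∀ F : Set ↥(hypSet n), IsH55 F → hVol n P = 16 * hVol n F

/-- The Coxeter simplex `H₁⁸ ⊂ H⁸`: the non-compact Coxeter simplex of minimal
volume in `H⁸`, with exactly one ideal vertex. -/
def IsH18 {n : ℕ} (P : Set ↥(hypSet n)) : Prop :=
  n = 8 ∧ hCoxSimplex n P ∧ ¬IsCompact P ∧ (hIdealVerts n P).ncard = 1 ∧
  ∀ Q : Set ↥(hypSet n), hCoxSimplex n Q → ¬IsCompact Q → hVol n P ≤ hVol n Q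

/-- The Coxeter simplex `H₄⁸ ⊂ H⁸`: non-compact, with exactly two ideal
vertices, whose Coxeter diagram contains a subdiagram of type `A₈`; its volume
is exactly `272` times that of `H₁⁸`. -/
def IsH48 {n : ℕ} (P : Set ↥(hypSet n)) : Prop :=
  n = 8 ∧ hCoxSimplex n P ∧ ¬IsCompact P ∧ (hIdealVerts n P).ncard = 2 ∧
  (∃ 𝒜, hSubOcc n P (cmA 8) 𝒜) ∧
  ∀ F : Set ↥(hypSet n), IsH18 F → hVol n P = 272 * hVol n F

/-- The Coxeter simplex `H₁⁹ ⊂ H⁹`: the non-compact Coxeter simplex of minimal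
volume in `H⁹`, with exactly one ideal vertex. -/
def IsH19 {n : ℕ} (P : Set ↥(hypSet n)) : Prop :=
  n = 9 ∧ hCoxSimplex n P ∧ ¬IsCompact P ∧ (hIdealVerts n P).ncard = 1 ∧
  ∀ Q : Set ↥(hypSet n), hCoxSimplex n Q → ¬IsCompact Q → hVol n P ≤ hVol n Q

/-- The Coxeter simplex `H₃⁹ ⊂ H⁹`: non-compact, with exactly three ideal
vertices; its volume is exactly `527` times that of `H₁⁹`. -/
def IsH39 {n : ℕ} (P : Set ↥(hypSet n)) : Prop :=
  n = 9 ∧ hCoxSimplex n P ∧ ¬IsCompact P ∧ (hIdealVerts n P).ncard = 3 ∧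
  ∀ F : Set ↥(hypSet n), IsH19 F → hVol n P = 527 * hVol n F

/-! ### Minkowski algebra -/

section Minkowski

variable {n : ℕ}

theorem mink_comm (x y : EuclideanSpace ℝ (Fin (n + 1))) : mink n x y = mink n y x := by
  simp only [mink, mul_comm]

theorem mink_add_left (x y z : EuclideanSpace ℝ (Fin (n + 1))) :
    mink n (x + y) z = mink n x z + mink n y z := by
  simp only [mink, PiLp.add_apply, add_mul, Finset.sum_add_distrib]; ring

theorem mink_smul_left (c : ℝ) (x z : EuclideanSpace ℝ (Fin (n + 1))) :
    mink n (c • x) z = c * mink n x z := by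
  simp only [mink, PiLp.smul_apply, smul_eq_mul, mul_assoc, ← Finset.mul_sum]; ring

theorem mink_add_right (x y z : EuclideanSpace ℝ (Fin (n + 1))) :
    mink n z (x + y) = mink n z x + mink n z y := by
  rw [mink_comm, mink_add_left, mink_comm x, mink_comm y]

theorem mink_smul_right (c : ℝ) (x z : EuclideanSpace ℝ (Fin (n + 1))) :
    mink n z (c • x) = c * mink n z x := by
  rw [mink_comm, mink_smul_left, mink_comm x]

/-- The functional `mink n v` as a linear map. -/
def minkL (v : EuclideanSpace ℝ (Fin (n + 1))) : EuclideanSpace ℝ (Fin (n + 1)) →ₗ[ℝ] ℝ where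
  toFun := mink n v
  map_add' x y := mink_add_right x y v
  map_smul' c x := mink_smul_right c x v

theorem mink_sub_right (x y z : EuclideanSpace ℝ (Fin (n + 1))) :
    mink n z (x - y) = mink n z x - mink n z y := map_sub (minkL z) x y

theorem mink_sub_left (x y z : EuclideanSpace ℝ (Fin (n + 1))) :
    mink n (x - y) z = mink n x z - mink n y z := by
  rw [mink_comm, mink_sub_right, mink_comm x, mink_comm y]

theorem mink_neg_right (x z : EuclideanSpace ℝ (Fin (n + 1))) :
    mink n z (-x) = -mink n z x := map_neg (minkL z) x

theorem mink_neg_left (x z : EuclideanSpace ℝ (Fin (n + 1))) :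
    mink n (-x) z = -mink n x z := by
  rw [mink_comm, mink_neg_right, mink_comm]

theorem mink_zero_right (z : EuclideanSpace ℝ (Fin (n + 1))) : mink n z 0 = 0 :=
  map_zero (minkL z)

theorem mink_zero_left (z : EuclideanSpace ℝ (Fin (n + 1))) : mink n 0 z = 0 := by
  rw [mink_comm, mink_zero_right]

theorem mink_sum_right {ι : Type*} (s : Finset ι) (f : ι → EuclideanSpace ℝ (Fin (n + 1)))
    (z : EuclideanSpace ℝ (Fin (n + 1))) :
    mink n z (∑ i ∈ s, f i) = ∑ i ∈ s, mink n z (f i) := map_sum (minkL z) f s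

theorem mink_sum_left {ι : Type*} (s : Finset ι) (f : ι → EuclideanSpace ℝ (Fin (n + 1)))
    (z : EuclideanSpace ℝ (Fin (n + 1))) :
    mink n (∑ i ∈ s, f i) z = ∑ i ∈ s, mink n (f i) z := by
  rw [mink_comm, mink_sum_right]; simp only [mink_comm]

theorem continuous_mink (v : EuclideanSpace ℝ (Fin (n + 1))) : Continuous (mink n v) := by
  unfold mink; fun_prop

theorem mink_self (x : EuclideanSpace ℝ (Fin (n + 1))) :
    mink n x x = -(x 0) ^ 2 + ∑ i : Fin n, x i.succ ^ 2 := by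
  simp only [mink, sq]

theorem ext_of_zero_succ {x : EuclideanSpace ℝ (Fin (n + 1))} (h0 : x 0 = 0)
    (h : ∑ i : Fin n, x i.succ ^ 2 ≤ 0) : x = 0 := by
  have h' : ∑ i : Fin n, x i.succ ^ 2 = 0 := le_antisymm h (by positivity)
  rw [Finset.sum_eq_zero_iff_of_nonneg (fun _ _ => by positivity)] at h'
  ext i
  refine Fin.cases h0 (fun j => ?_) i
  simpa using h' j (Finset.mem_univ _)

theorem eq_zero_of_mink_self_nonpos {x : EuclideanSpace ℝ (Fin (n + 1))} (h0 : x 0 = 0)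
    (h : mink n x x ≤ 0) : x = 0 := by
  refine ext_of_zero_succ h0 ?_
  rw [mink_self, h0] at h
  simpa using h

theorem mink_nondegenerate {x : EuclideanSpace ℝ (Fin (n + 1))} (h : ∀ y, mink n x y = 0) :
    x = 0 := by
  have h0 : x 0 = 0 := by
    have := h (EuclideanSpace.single 0 1)
    simpa [mink] using this
  exact eq_zero_of_mink_self_nonpos h0 (h x).le

/-- The orthogonal complement of a point of the hyperboloid is positive definite. -/
theorem eq_zero_of_orthogonal {q v : EuclideanSpace ℝ (Fin (n + 1))} (hq : q ∈ hypSet n)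
    (hv : mink n q v = 0) (h : mink n v v ≤ 0) : v = 0 := by
  obtain ⟨hq1, hq0⟩ := hq
  rw [mink_self] at hq1 h
  have cs := Finset.sum_mul_sq_le_sq_mul_sq Finset.univ (fun i : Fin n => q i.succ)
    (fun i : Fin n => v i.succ)
  have e : ∑ i : Fin n, q i.succ * v i.succ = q 0 * v 0 := by unfold mink at hv; linarith
  rw [e, show ∑ i : Fin n, q i.succ ^ 2 = q 0 ^ 2 - 1 by linarith] at cs
  have hS : 0 ≤ ∑ i : Fin n, v i.succ ^ 2 := by positivity
  have hv0 : v 0 = 0 := by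
    have h1 : 0 ≤ q 0 ^ 2 - 1 := by
      have : 0 ≤ ∑ i : Fin n, q i.succ ^ 2 := by positivity
      linarith
    have : v 0 ^ 2 ≤ 0 := by nlinarith
    exact pow_eq_zero_iff (two_ne_zero) |>.1 (le_antisymm this (sq_nonneg _))
  refine ext_of_zero_succ hv0 ?_
  rw [hv0] at h; linarith

theorem mink_self_pos_of_orthogonal {q v : EuclideanSpace ℝ (Fin (n + 1))} (hq : q ∈ hypSet n)
    (hv : mink n q v = 0) (h : v ≠ 0) : 0 < mink n v v := by
  by_contra! h'
  exact h (eq_zero_of_orthogonal hq hv h')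

/-- A future causal vector pairs negatively with a point of the hyperboloid. -/
theorem mink_neg_of_causal {q z : EuclideanSpace ℝ (Fin (n + 1))} (hq : q ∈ hypSet n)
    (hz : mink n z z ≤ 0) (hz0 : 0 < z 0) : mink n q z < 0 := by
  have hq0 := hq.2
  have hq1 := hq.1
  by_contra! h
  rw [mink_self] at hq1 hz
  have cs := Finset.sum_mul_sq_le_sq_mul_sq Finset.univ (fun i : Fin n => q i.succ)
    (fun i : Fin n => z i.succ)
  have e : q 0 * z 0 ≤ ∑ i : Fin n, q i.succ * z i.succ := by unfold mink at h; linarith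
  have e2 : (q 0 * z 0) ^ 2 ≤ (∑ i : Fin n, q i.succ * z i.succ) ^ 2 :=
    pow_le_pow_left₀ (by positivity) e 2
  rw [show ∑ i : Fin n, q i.succ ^ 2 = q 0 ^ 2 - 1 by linarith] at cs
  have h1 : 0 ≤ q 0 ^ 2 - 1 := by
    have : 0 ≤ ∑ i : Fin n, q i.succ ^ 2 := by positivity
    linarith
  nlinarith [pow_pos hz0 2]

theorem zero_lt_of_causal {q z : EuclideanSpace ℝ (Fin (n + 1))} (hq : q ∈ hypSet n)
    (hz : mink n z z ≤ 0) (h : mink n q z < 0) : 0 < z 0 := by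
  by_contra! h0
  rcases h0.lt_or_eq with h0 | h0
  · have := mink_neg_of_causal hq (z := -z) (by simpa [mink_neg_left, mink_neg_right] using hz)
      (by simpa using h0)
    rw [mink_neg_right] at this
    linarith
  · rw [eq_zero_of_mink_self_nonpos h0 hz, mink_zero_right] at h
    exact lt_irrefl _ h

theorem eq_of_mink_ge {p q : EuclideanSpace ℝ (Fin (n + 1))} (hp : p ∈ hypSet n)
    (hq : q ∈ hypSet n) (h : -1 ≤ mink n p q) : p = q := by
  have hneg := mink_neg_of_causal hp (by rw [hq.1]; norm_num) hq.2
  have h1 : mink n p q = -1 := by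
    by_contra hne
    have hlt : -1 < mink n p q := lt_of_le_of_ne h (Ne.symm hne)
    have ho : mink n p (q + mink n p q • p) = 0 := by
      rw [mink_add_right, mink_smul_right, hp.1]; ring
    have hs : mink n (q + mink n p q • p) (q + mink n p q • p) = mink n p q ^ 2 - 1 := by
      simp only [mink_add_right, mink_add_left, mink_smul_right, mink_smul_left, hp.1, hq.1,
        mink_comm q p]
      ring
    have h0 := eq_zero_of_orthogonal hp ho (by rw [hs]; nlinarith)
    rw [h0, mink_zero_left] at hs
    nlinarith
  have := eq_zero_of_orthogonal hp (v := q - p)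
    (by rw [mink_sub_right, hp.1, h1]; ring)
    (by simp only [mink_sub_right, mink_sub_left, hp.1, hq.1, mink_comm q p, h1]; norm_num)
  exact (sub_eq_zero.1 this).symm

theorem smul_mem_hypSet {x : EuclideanSpace ℝ (Fin (n + 1))} (h : mink n x x < 0) (h0 : 0 < x 0) :
    (√(-mink n x x))⁻¹ • x ∈ hypSet n := by
  have hs : 0 < √(-mink n x x) := Real.sqrt_pos.2 (by linarith)
  refine ⟨?_, ?_⟩
  · have := Real.mul_self_sqrt (show 0 ≤ -mink n x x by linarith)
    rw [mink_smul_left, mink_smul_right]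
    field_simp
    nlinarith
  · simp only [PiLp.smul_apply, smul_eq_mul]; positivity

theorem exists_smul_mem_hypSet {x : EuclideanSpace ℝ (Fin (n + 1))} (h : mink n x x < 0)
    (h0 : 0 < x 0) : ∃ s : ℝ, 0 < s ∧ s • x ∈ hypSet n :=
  ⟨_, inv_pos.2 (Real.sqrt_pos.2 (by linarith)), smul_mem_hypSet h h0⟩

/-- Adding a nonnegative multiple of a future causal vector keeps a point timelike. -/
theorem exists_smul_add_mem_hypSet {x z : EuclideanSpace ℝ (Fin (n + 1))} (hx : x ∈ hypSet n)
    (hz : mink n z z ≤ 0) (hz0 : 0 < z 0) {r : ℝ} (hr : 0 ≤ r) :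
    ∃ s : ℝ, 0 < s ∧ s • (x + r • z) ∈ hypSet n := by
  apply exists_smul_mem_hypSet
  · simp only [mink_add_right, mink_add_left, mink_smul_right, mink_smul_left, hx.1,
      mink_comm z x]
    have := mink_neg_of_causal hx hz hz0
    have h1 : r * mink n x z ≤ 0 := mul_nonpos_of_nonneg_of_nonpos hr this.le
    have h2 : r * (r * mink n z z) ≤ 0 :=
      mul_nonpos_of_nonneg_of_nonpos hr (mul_nonpos_of_nonneg_of_nonpos hr hz)
    linarith
  · have := hx.2
    simp only [PiLp.add_apply, PiLp.smul_apply, smul_eq_mul]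
    positivity

/-- Every direction at a point of `H^n` can be followed for a short time inside a
neighbourhood of that point. -/
theorem eventually_perturb (x : ↥(hypSet n)) {U : Set ↥(hypSet n)} (hU : U ∈ nhds x)
    (η : EuclideanSpace ℝ (Fin (n + 1))) :
    ∀ᶠ ε : ℝ in nhdsWithin 0 (Ioi 0), ∃ y ∈ U, ∃ s : ℝ, 0 < s ∧
      (y : EuclideanSpace ℝ (Fin (n + 1))) = s • (x.val + ε • η) := by
  set c : ℝ → EuclideanSpace ℝ (Fin (n + 1)) := fun ε => x.val + ε • η with hc
  have hc0 : c 0 = x.val := by simp [hc]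
  have hcc : Continuous c := by fun_prop
  have hm : Continuous fun ε => mink n (c ε) (c ε) := by
    unfold mink; fun_prop
  have h0 : Continuous fun ε => c ε 0 := by fun_prop
  have ev1 : ∀ᶠ ε in nhds (0 : ℝ), mink n (c ε) (c ε) < 0 :=
    hm.continuousAt.eventually_lt continuousAt_const (by rw [hc0, x.2.1]; norm_num)
  have ev2 : ∀ᶠ ε in nhds (0 : ℝ), 0 < c ε 0 :=
    continuousAt_const.eventually_lt h0.continuousAt (by rw [hc0]; exact x.2.2)
  have hlim : Filter.Tendsto (fun ε => (√(-mink n (c ε) (c ε)))⁻¹ • c ε) (nhds 0) (nhds x.val) := by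
    have hsq : Continuous fun ε => √(-mink n (c ε) (c ε)) := Real.continuous_sqrt.comp hm.neg
    have : ContinuousAt (fun ε => (√(-mink n (c ε) (c ε)))⁻¹ • c ε) 0 :=
      (hsq.continuousAt.inv₀ (by rw [hc0, x.2.1]; norm_num)).smul hcc.continuousAt
    have h2 := this.tendsto
    rw [hc0, x.2.1] at h2
    simpa using h2
  obtain ⟨V, hV, hVU⟩ := mem_nhds_induced Subtype.val x U |>.1 hU
  filter_upwards [nhdsWithin_le_nhds ev1, nhdsWithin_le_nhds ev2,
    nhdsWithin_le_nhds (hlim hV)] with ε e1 e2 e3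
  exact ⟨⟨_, smul_mem_hypSet e1 e2⟩, hVU e3, _,
    inv_pos.2 (Real.sqrt_pos.2 (by linarith)), rfl⟩

end Minkowski

/-! ### Finite volume forces the cone over a polyhedron to be causal -/

section Volume

open scoped Pointwise

/-- The Klein volume element is not integrable near a point of the absolute. -/
theorem lintegral_klein_eq_top {n : ℕ} (hn : 3 ≤ n) {C S : Set (Fin n → ℝ)} (hCo : IsOpen C)
    (hCn : C.Nonempty) (hC : ∀ r : ℝ, 0 < r → ∀ y ∈ C, r • y ∈ C) {ρ : ℝ} (hρ0 : 0 < ρ)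
    (hρ : ρ < 1) (hS : ∀ y ∈ C, ρ ^ 2 ≤ ∑ i, y i ^ 2 → ∑ i, y i ^ 2 < 1 → y ∈ S) :
    ∫⁻ y in S, ENNReal.ofReal ((1 - ∑ i, y i ^ 2) ^ (-((n : ℝ) + 1) / 2)) ∂(volume) = ⊤ := by
  by_contra hI
  set I := ∫⁻ y in S, ENNReal.ofReal ((1 - ∑ i, y i ^ 2) ^ (-((n : ℝ) + 1) / 2)) ∂(volume) with hIdef
  set D : ℝ → Set (Fin n → ℝ) := fun r => {y | y ∈ C ∧ ∑ i, y i ^ 2 < r ^ 2} with hD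
  have hDo : ∀ r, IsOpen (D r) := fun r =>
    hCo.inter (isOpen_lt (f := fun y : Fin n → ℝ => ∑ i, y i ^ 2) (by fun_prop) continuous_const)
  have hscale : ∀ r : ℝ, 0 < r → D r = r • D 1 := by
    intro r hr
    ext y
    rw [Set.mem_smul_set_iff_inv_smul_mem₀ hr.ne']
    simp only [hD, mem_ofPred_eq, Pi.smul_apply, smul_eq_mul, mul_pow, ← Finset.mul_sum]
    refine and_congr ⟨hC _ (inv_pos.2 hr) y, fun h => ?_⟩ ?_
    · have := hC r hr _ h
      rwa [smul_inv_smul₀ hr.ne'] at this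
    · rw [inv_pow, inv_mul_lt_iff₀ (by positivity)]; simp
  have hV0 : volume (D 1) ≠ 0 := by
    obtain ⟨y, hy⟩ := hCn
    have hs : 0 ≤ ∑ i, y i ^ 2 := by positivity
    refine ((hDo 1).measure_pos volume ⟨(1 + ∑ i, y i ^ 2)⁻¹ • y,
      hC _ (by positivity) y hy, ?_⟩).ne'
    simp only [Pi.smul_apply, smul_eq_mul, mul_pow, ← Finset.mul_sum]
    rw [inv_pow, inv_mul_lt_iff₀ (by positivity)]
    nlinarith
  have hVt : volume (D 1) ≠ ⊤ := by
    refine ((measure_mono ?_).trans_lt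
      (measure_closedBall_lt_top (x := (0 : Fin n → ℝ)) (r := 1))).ne
    intro y hy
    rw [mem_closedBall_zero_iff, pi_norm_le_iff_of_nonneg zero_le_one]
    intro i
    have h1 : y i ^ 2 ≤ ∑ i, y i ^ 2 :=
      Finset.single_le_sum (f := fun i => y i ^ 2) (fun _ _ => sq_nonneg _) (Finset.mem_univ i)
    have h2 := hy.2
    rw [Real.norm_eq_abs, ← sq_le_one_iff_abs_le_one]
    linarith
  set a := (volume (D 1)).toReal with ha
  have ha0 : 0 < a := ENNReal.toReal_pos hV0 hVt
  set b := I.toReal with hb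
  have hb0 : 0 ≤ b := ENNReal.toReal_nonneg
  have key : ∀ r, ρ ≤ r → r < 1 → a ≤ 4 * (1 - r) * b := by
    intro r hr hr1
    have hr0 : 0 < r := hρ0.trans_le hr
    have hsub : D r ⊆ D 1 := fun y hy => ⟨hy.1, hy.2.trans (by nlinarith)⟩
    have hvol : volume (D 1 \ D r) = ENNReal.ofReal ((1 - r ^ n) * a) := by
      rw [measure_sdiff hsub (hDo r).measurableSet.nullMeasurableSet
        ((measure_mono hsub).trans_lt hVt.lt_top).ne, hscale r hr0,
        Measure.addHaar_smul_of_nonneg _ hr0.le, Module.finrank_fin_fun,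
        ← ENNReal.ofReal_toReal hVt, ← ha, ← ENNReal.ofReal_mul (by positivity),
        ← ENNReal.ofReal_sub _ (by positivity)]
      ring_nf
    have hle : ENNReal.ofReal (((1 - r ^ 2) ^ 2)⁻¹) * volume (D 1 \ D r) ≤ I := by
      rw [← setLIntegral_const]
      refine (setLIntegral_mono' ((hDo 1).measurableSet.diff (hDo r).measurableSet) ?_).trans
        (lintegral_mono_set ?_)
      · intro y hy
        have hyr : r ^ 2 ≤ ∑ i, y i ^ 2 := by
          by_contra! h; exact hy.2 ⟨hy.1.1, h⟩
        have hy1 : ∑ i, y i ^ 2 < 1 := by simpa using hy.1.2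
        apply ENNReal.ofReal_le_ofReal
        have hpos : 0 < 1 - ∑ i, y i ^ 2 := by linarith
        have h0 : (0 : ℝ) ≤ ∑ i, y i ^ 2 := by positivity
        have h3 : (3 : ℝ) ≤ n := by exact_mod_cast hn
        calc ((1 - r ^ 2) ^ 2)⁻¹ ≤ ((1 - ∑ i, y i ^ 2) ^ 2)⁻¹ := by
              gcongr
          _ = (1 - ∑ i, y i ^ 2) ^ (-2 : ℝ) := by
              rw [Real.rpow_neg hpos.le]; norm_num
          _ ≤ _ := Real.rpow_le_rpow_of_exponent_ge hpos (by linarith) (by linarith)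
      · intro y hy
        have hyr : r ^ 2 ≤ ∑ i, y i ^ 2 := by
          by_contra! h; exact hy.2 ⟨hy.1.1, h⟩
        exact hS y hy.1.1 (le_trans (by gcongr) hyr) (by simpa using hy.1.2)
    rw [hvol, ← ENNReal.ofReal_mul (by positivity), ENNReal.ofReal_le_iff_le_toReal hI, ← hb,
      inv_mul_le_iff₀ (by have : 0 < 1 - r ^ 2 := by nlinarith
                          positivity)] at hle
    have hrn : r ^ n ≤ r := pow_le_of_le_one hr0.le hr1.le (by omega)
    have h1 : (1 - r) * a ≤ (1 - r) * (4 * (1 - r) * b) := by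
      calc (1 - r) * a ≤ (1 - r ^ n) * a := by gcongr
        _ ≤ (1 - r ^ 2) ^ 2 * b := hle
        _ = (1 - r) ^ 2 * (1 + r) ^ 2 * b := by ring
        _ ≤ (1 - r) ^ 2 * 2 ^ 2 * b := by gcongr; linarith
        _ = _ := by ring
    exact le_of_mul_le_mul_left h1 (by linarith)
  have hlim : ∀ᶠ r in nhdsWithin (1 : ℝ) (Iio 1), 4 * (1 - r) * b < a := by
    have : Continuous fun r : ℝ => 4 * (1 - r) * b := by fun_prop
    exact nhdsWithin_le_nhds (this.continuousAt.eventually_lt continuousAt_const (by simpa))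
  obtain ⟨r, h1, h2⟩ := (hlim.and (Ioo_mem_nhdsLT hρ)).exists
  exact absurd (key r h2.1.le h2.2) (not_le.2 h1)

variable {n : ℕ} {ι : Type*} [Finite ι] {v : ι → EuclideanSpace ℝ (Fin (n + 1))}
  {p x : EuclideanSpace ℝ (Fin (n + 1))}

/-- If a lightlike vector lies strictly inside all the half-spaces, their intersection
has infinite volume. -/
theorem hVol_eq_top_of_lightlike (hn : 3 ≤ n) {m : EuclideanSpace ℝ (Fin (n + 1))}
    (hm : mink n m m = 0) (hm0 : m 0 = 1) (hv : ∀ i, mink n (v i) m < 0) :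
    hVol n (⋂ i, hHalf n (v i)) = ⊤ := by
  set L : ι → ℝ → (Fin n → ℝ) → ℝ := fun i s y => -(v i 0 * s) + ∑ j, v i j.succ * y j with hL
  set N : (Fin n → ℝ) → ℝ := fun y => √(∑ i, y i ^ 2) with hN
  set y₀ : Fin n → ℝ := fun j => m j.succ with hy₀
  have hNy : N y₀ = 1 := by
    rw [mink_self, hm0] at hm
    simp only [hN, hy₀, show ∑ i : Fin n, m i.succ ^ 2 = 1 by linarith, Real.sqrt_one]
  have hLy : ∀ i, L i 1 y₀ < 0 := by
    intro i
    have := hv i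
    unfold mink at this
    rwa [hm0] at this
  have hev : ∀ᶠ κ in nhdsWithin (1 : ℝ) (Ioi 1), ∀ i, L i κ y₀ < 0 := by
    rw [Filter.eventually_all]
    intro i
    have : Continuous fun κ : ℝ => L i κ y₀ := by fun_prop
    exact nhdsWithin_le_nhds (this.continuousAt.eventually_lt continuousAt_const (hLy i))
  obtain ⟨κ, hκ, hκ1⟩ := (hev.and self_mem_nhdsWithin).exists
  have hκ1 : 1 < κ := hκ1
  have hκ0 : 0 < κ := by linarith
  set C : Set (Fin n → ℝ) := {y | ∀ i, L i (N y) y < 0 ∧ L i (κ * N y) y < 0} with hC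
  have hNc : Continuous N := by fun_prop
  have hNs : ∀ r : ℝ, 0 < r → ∀ y, N (r • y) = r * N y := by
    intro r hr y
    simp only [hN, Pi.smul_apply, smul_eq_mul, mul_pow, ← Finset.mul_sum]
    rw [Real.sqrt_mul (by positivity), Real.sqrt_sq hr.le]
  have hLs : ∀ i (r s : ℝ) y, L i (r * s) (r • y) = r * L i s y := by
    intro i r s y
    simp only [hL, Pi.smul_apply, smul_eq_mul, mul_add, Finset.mul_sum]
    congr 1
    · ring
    · exact Finset.sum_congr rfl fun _ _ => by ring
  refine lintegral_klein_eq_top hn (C := C) (ρ := κ⁻¹) ?_ ⟨y₀, ?_⟩ ?_ (inv_pos.2 hκ0)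
    (inv_lt_one_of_one_lt₀ hκ1) ?_
  · have hCi : C = ⋂ i, {y | L i (N y) y < 0} ∩ {y | L i (κ * N y) y < 0} := by
      ext y; simp [hC]
    rw [hCi]
    refine isOpen_iInter_of_finite fun i => IsOpen.inter ?_ ?_
    · exact isOpen_lt (f := fun y => L i (N y) y) (by fun_prop) continuous_const
    · exact isOpen_lt (f := fun y => L i (κ * N y) y) (by fun_prop) continuous_const
  · intro i
    rw [hNy, mul_one]
    exact ⟨hLy i, hκ i⟩
  · intro r hr y hy i
    rw [hNs r hr, mul_left_comm, hLs, hLs]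
    exact ⟨mul_neg_of_pos_of_neg hr (hy i).1, mul_neg_of_pos_of_neg hr (hy i).2⟩
  · intro y hy h1 h2
    have hN1 : N y < 1 := by
      rw [hN]; simp only; rw [Real.sqrt_lt' one_pos]; simpa using h2
    have hN2 : 1 ≤ κ * N y := by
      have : κ⁻¹ ≤ N y := Real.le_sqrt_of_sq_le h1
      rwa [inv_le_iff_one_le_mul₀' hκ0] at this
    set z : EuclideanSpace ℝ (Fin (n + 1)) := WithLp.toLp 2 (Fin.cons 1 y) with hz
    have hz0 : z 0 = 1 := rfl
    have hzs : ∀ j : Fin n, z j.succ = y j := fun j => rfl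
    have hzz : mink n z z < 0 := by
      rw [mink_self]; simp only [hz0, hzs]; linarith
    obtain ⟨s, hs, hsz⟩ := exists_smul_mem_hypSet hzz (by rw [hz0]; exact one_pos)
    refine ⟨⟨s • z, hsz⟩, mem_iInter.2 fun i => ?_, ?_⟩
    · have hi := hy i
      change mink n (v i) (s • z) ≤ 0
      rw [mink_smul_right]
      have : mink n (v i) z = L i 1 y := by
        simp only [mink, hz0, hzs, hL]
      rw [this]
      refine (mul_neg_of_pos_of_neg hs ?_).le
      simp only [hL] at hi ⊢
      rcases le_total 0 (v i 0) with h | h <;> nlinarith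
    · funext j
      simp only [klein, PiLp.smul_apply, smul_eq_mul, hz0, hzs]
      field_simp

/-- In a finite volume polyhedron with interior point `p`, the recession directions are causal. -/
theorem mink_self_nonpos_of_hVol_lt_top (hn : 3 ≤ n) (hp : p ∈ hypSet n)
    (hvp : ∀ i, mink n (v i) p < 0) (hvol : hVol n (⋂ i, hHalf n (v i)) < ⊤)
    (hvx : ∀ i, mink n (v i) x ≤ 0) : mink n x x ≤ 0 := by
  by_contra! hx
  set A := mink n x x with hA
  set b := mink n p x with hb
  set t := (-b + √(b ^ 2 + A)) / A with ht
  have hsq : √(b ^ 2 + A) ^ 2 = b ^ 2 + A := Real.sq_sqrt (by positivity)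
  have hgt : |b| < √(b ^ 2 + A) := by
    rw [Real.lt_sqrt (abs_nonneg _), sq_abs]; linarith
  have ht0 : 0 < t := div_pos (by linarith [le_abs_self b]) hx
  have htA : t * A = -b + √(b ^ 2 + A) := by rw [ht]; field_simp
  have hroot : -1 + 2 * t * b + t ^ 2 * A = 0 := by
    have : A * (-1 + 2 * t * b + t ^ 2 * A) = 0 := by
      have : A * (-1 + 2 * t * b + t ^ 2 * A) = -A + 2 * (t * A) * b + (t * A) ^ 2 := by ring
      rw [this, htA]; linear_combination hsq
    exact (mul_eq_zero.1 this).resolve_left hx.ne'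
  set z := p + t • x with hz
  have hzz : mink n z z = 0 := by
    simp only [hz, mink_add_right, mink_add_left, mink_smul_right, mink_smul_left, hp.1,
      mink_comm x p, ← hA, ← hb]
    linarith
  have hpz : mink n p z < 0 := by
    rw [hz, mink_add_right, mink_smul_right, hp.1, ← hb]
    nlinarith [mul_pos ht0 ht0, mul_pos (mul_pos ht0 ht0) hx]
  have hz0 := zero_lt_of_causal hp hzz.le hpz
  refine hvol.ne (hVol_eq_top_of_lightlike hn (m := (z 0)⁻¹ • z) ?_ ?_ fun i => ?_)
  · rw [mink_smul_left, mink_smul_right, hzz]; simp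
  · simp [hz0.ne']
  · rw [mink_smul_right, hz, mink_add_right, mink_smul_right]
    exact mul_neg_of_pos_of_neg (inv_pos.2 hz0) (add_neg_of_neg_of_nonpos (hvp i)
      (mul_nonpos_of_nonneg_of_nonpos ht0.le (hvx i)))

theorem zero_nonneg_of_hVol_lt_top [Nonempty ι] (hn : 3 ≤ n) (hp : p ∈ hypSet n)
    (hvp : ∀ i, mink n (v i) p < 0) (hvol : hVol n (⋂ i, hHalf n (v i)) < ⊤)
    (hvx : ∀ i, mink n (v i) x ≤ 0) : 0 ≤ x 0 := by
  by_contra! hx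
  set t := p 0 / (-x 0) with ht
  have ht0 : 0 < t := div_pos hp.2 (by linarith)
  have hi : ∀ i, mink n (v i) (p + t • x) < 0 := fun i => by
    rw [mink_add_right, mink_smul_right]
    exact add_neg_of_neg_of_nonpos (hvp i) (mul_nonpos_of_nonneg_of_nonpos ht0.le (hvx i))
  have h0 : p + t • x = 0 := eq_zero_of_mink_self_nonpos
    (by simp only [PiLp.add_apply, PiLp.smul_apply, smul_eq_mul, ht]; field_simp [hx.ne]; ring)
    (mink_self_nonpos_of_hVol_lt_top hn hp hvp hvol fun i => (hi i).le)
  have := hi (Classical.arbitrary ι)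
  rw [h0, mink_zero_right] at this
  exact lt_irrefl _ this

end Volume

/-! ### Facets of a simplex -/

section Facets

variable {n : ℕ}

theorem isOpen_mink_neg (v : EuclideanSpace ℝ (Fin (n + 1))) :
    IsOpen {x : ↥(hypSet n) | mink n v x.val < 0} :=
  isOpen_lt (f := fun x : ↥(hypSet n) => mink n v x.val)
    ((continuous_mink v).comp continuous_subtype_val) continuous_const

theorem isClosed_hHalf (v : EuclideanSpace ℝ (Fin (n + 1))) : IsClosed (hHalf n v) :=
  isClosed_le (f := fun x : ↥(hypSet n) => mink n v x.val)
    ((continuous_mink v).comp continuous_subtype_val) continuous_const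

theorem mem_iInter_hHalf {ι : Sort*} {v : ι → EuclideanSpace ℝ (Fin (n + 1))}
    {x : ↥(hypSet n)} : x ∈ ⋂ i, hHalf n (v i) ↔ ∀ i, mink n (v i) x.val ≤ 0 := mem_iInter

/-- An interior point of a set contained in a half-space is strictly inside it. -/
theorem mink_neg_of_mem_interior {P : Set ↥(hypSet n)} {v : EuclideanSpace ℝ (Fin (n + 1))}
    (hv : mink n v v = 1) (hP : P ⊆ hHalf n v) {p : ↥(hypSet n)} (hp : p ∈ interior P) :
    mink n v p.val < 0 := by
  refine lt_of_le_of_ne (hP (interior_subset hp)) fun h0 => ?_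
  obtain ⟨ε, ⟨y, hy, s, hs, hys⟩, hε⟩ :=
    ((eventually_perturb p (mem_interior_iff_mem_nhds.1 hp) v).and self_mem_nhdsWithin).exists
  have h1 : mink n v y.val ≤ 0 := hP hy
  rw [hys, mink_smul_right, mink_add_right, mink_smul_right, h0, hv] at h1
  have hε : 0 < ε := hε
  nlinarith [mul_pos hs hε]

/-- A unit normal `u` of a facet which is orthogonal to `u - ⟨u, v⟩ v` is `± v`. -/
theorem eq_smul_of_orthogonal {u v : EuclideanSpace ℝ (Fin (n + 1))} (hu : mink n u u = 1)
    (hv : mink n v v = 1) {z : EuclideanSpace ℝ (Fin (n + 1))} (hz : z ∈ hypSet n)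
    (hzu : mink n u z = 0) (hzv : mink n v z = 0)
    (h : mink n u (u - mink n u v • v) = 0) : ∃ c : ℝ, c ≠ 0 ∧ u = c • v := by
  have h0 : u - mink n u v • v = 0 := by
    refine eq_zero_of_orthogonal hz ?_ ?_
    · rw [mink_sub_right, mink_smul_right, mink_comm z u, mink_comm z v, hzu, hzv]; ring
    · rw [mink_sub_left, h, mink_smul_left, mink_sub_right, mink_smul_right, hv, mink_comm v u]
      simp
  refine ⟨mink n u v, fun hc => ?_, sub_eq_zero.1 h0⟩
  rw [hc, zero_smul, sub_zero] at h0
  rw [h0, mink_zero_left] at hu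
  exact zero_ne_one hu

theorem hWall_smul {c : ℝ} (hc : c ≠ 0) (v : EuclideanSpace ℝ (Fin (n + 1))) :
    hWall n (c • v) = hWall n v := by
  ext x
  simp [hWall, mink_smul_left, hc]

variable {ι : Type*} [Finite ι] {P : Set ↥(hypSet n)} {e : ι → EuclideanSpace ℝ (Fin (n + 1))}

theorem hIsFacet_of_strict (hP : P = ⋂ i, hHalf n (e i)) (he : ∀ i, mink n (e i) (e i) = 1)
    {i : ι} {z : ↥(hypSet n)} (hzi : mink n (e i) z.val = 0)
    (hz : ∀ j, j ≠ i → mink n (e j) z.val < 0) : hIsFacet n P (P ∩ hWall n (e i)) := by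
  subst hP
  have hmem : z ∈ (⋂ i, hHalf n (e i)) ∩ hWall n (e i) := by
    refine ⟨mem_iInter.2 fun j => ?_, hzi⟩
    by_cases hj : j = i
    · subst hj; exact hzi.le
    · exact (hz j hj).le
  refine ⟨⟨z, hmem⟩, e i, he i, iInter_subset _ i, rfl, fun u hu hsub => ?_⟩
  have hzu : mink n u z.val = 0 := hsub hmem
  have hU : (⋂ j : {j // j ≠ i}, {x : ↥(hypSet n) | mink n (e j) x.val < 0}) ∈ nhds z :=
    (isOpen_iInter_of_finite fun j : {j // j ≠ i} => isOpen_mink_neg (e j)).mem_nhds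
      (mem_iInter.2 fun j => hz j j.2)
  obtain ⟨ε, ⟨y, hy, s, hs, hys⟩, hε⟩ :=
    ((eventually_perturb z hU (u - mink n u (e i) • e i)).and self_mem_nhdsWithin).exists
  have hε : 0 < ε := hε
  have hyi : mink n (e i) y.val = 0 := by
    rw [hys, mink_smul_right, mink_add_right, mink_smul_right, mink_sub_right, mink_smul_right,
      hzi, he, mink_comm (e i) u]
    ring
  have hyu : mink n u y.val = 0 := by
    refine hsub ⟨mem_iInter.2 fun j => ?_, hyi⟩
    by_cases hj : j = i
    · subst hj; exact hyi.le
    · have h : mink n (e j) y.val < 0 := mem_iInter.1 hy ⟨j, hj⟩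
      exact h.le
  rw [hys, mink_smul_right, mink_add_right, mink_smul_right, hzu, zero_add] at hyu
  obtain ⟨c, hc, rfl⟩ := eq_smul_of_orthogonal hu (he i) z.2 hzu hzi
    (by simpa [hs.ne', hε.ne'] using hyu)
  exact hWall_smul hc _

theorem exists_eq_of_hIsFacet [Nonempty ι] (hP : P = ⋂ i, hHalf n (e i))
    (he : ∀ i, mink n (e i) (e i) = 1) {S : Set ↥(hypSet n)} (hS : hIsFacet n P S) :
    ∃ i, S = P ∩ hWall n (e i) := by
  obtain ⟨-, v, hv, hPv, hSv, huniq⟩ := hS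
  by_contra! hne
  have hex : ∀ i, ∃ z ∈ S, mink n (e i) z.val < 0 := by
    intro i
    by_contra! hcon
    refine hne i ?_
    have hsub : S ⊆ hWall n (e i) := fun z hz => by
      have : z ∈ P := by rw [hSv] at hz; exact hz.1
      rw [hP] at this
      exact le_antisymm (mem_iInter_hHalf.1 this i) (hcon z hz)
    rw [huniq _ (he i) hsub, ← hSv]
  choose z hzS hz using hex
  have := Fintype.ofFinite ι
  have hzP : ∀ i j, mink n (e i) (z j).val ≤ 0 := fun i j => by
    have : z j ∈ P := by have := hzS j; rw [hSv] at this; exact this.1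
    rw [hP] at this
    exact mem_iInter_hHalf.1 this i
  have hzv : ∀ j, mink n v (z j).val = 0 := fun j => by
    have := hzS j
    rw [hSv] at this
    exact this.2
  have hZ : mink n (∑ i, (z i).val) (∑ i, (z i).val) < 0 := by
    simp only [mink_sum_left, mink_sum_right]
    refine Finset.sum_neg (fun i _ => Finset.sum_neg (fun j _ => ?_) Finset.univ_nonempty)
      Finset.univ_nonempty
    exact mink_neg_of_causal (z j).2 (by rw [(z i).2.1]; norm_num) (z i).2.2
  have hZ0 : 0 < (∑ i, (z i).val) 0 := by
    rw [WithLp.ofLp_sum, Finset.sum_apply]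
    exact Finset.sum_pos (fun i _ => (z i).2.2) Finset.univ_nonempty
  obtain ⟨s, hs, hsZ⟩ := exists_smul_mem_hypSet hZ hZ0
  set y : ↥(hypSet n) := ⟨_, hsZ⟩ with hy
  have hyi : y ∈ interior P := by
    refine mem_interior.2 ⟨⋂ i, {x : ↥(hypSet n) | mink n (e i) x.val < 0}, ?_,
      isOpen_iInter_of_finite fun i => isOpen_mink_neg (e i), mem_iInter.2 fun i => ?_⟩
    · rw [hP]
      exact iInter_mono fun i x (hx : mink n (e i) x.val < 0) => hx.le
    · change mink n (e i) (s • ∑ i, (z i).val) < 0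
      rw [mink_smul_right, mink_sum_right]
      exact mul_neg_of_pos_of_neg hs
        (Finset.sum_neg' (fun j _ => hzP i j) ⟨i, Finset.mem_univ _, hz i⟩)
  refine (mink_neg_of_mem_interior hv hPv hyi).ne ?_
  rw [hy]
  simp only [mink_smul_right, mink_sum_right, hzv, Finset.sum_const_zero, mul_zero]

end Facets

/-- `e` are outward normals of the facets of the simplex `P`, and `f` are the (negated) dual
vectors: they span the extremal rays of the cone over `P`. -/
structure IsFrame (n : ℕ) (P : Set ↥(hypSet n)) {ι : Type*} [Fintype ι] [DecidableEq ι]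
    (e f : ι → EuclideanSpace ℝ (Fin (n + 1))) : Prop where
  eq_iInter : P = ⋂ i, hHalf n (e i)
  dual : ∀ i j, mink n (e i) (f j) = if i = j then -1 else 0
  separating : ∀ x, (∀ i, mink n (e i) x = 0) → x = 0
  causal : ∀ j, mink n (f j) (f j) ≤ 0
  future : ∀ j, 0 < f j 0
  card_eq : Fintype.card ι = n + 1
  facet : ∀ S, hIsFacet n P S → ∃ i, S = P ∩ hWall n (e i)
  unit : ∀ i, mink n (e i) (e i) = 1

theorem exists_isFrame {n : ℕ} (hn : 3 ≤ n) {P : Set ↥(hypSet n)} (hP : hIsSimplex n P) :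
    ∃ (ι : Type) (_ : Fintype ι) (_ : DecidableEq ι) (e f : ι → EuclideanSpace ℝ (Fin (n + 1))),
      IsFrame n P e f := by
  obtain ⟨⟨k, v, hv, hPv, ⟨p, hp⟩, hvol⟩, hcard⟩ := hP
  obtain ⟨s, hs⟩ := exists_minimal_of_wellFoundedLT
    (fun s : Finset (Fin k) => P = ⋂ i : s, hHalf n (v i)) ⟨Finset.univ, by
      rw [hPv]; ext x; rw [mem_iInter_hHalf, mem_iInter_hHalf]; simp⟩
  have hPs := hs.prop
  have hps : ∀ i : s, mink n (v i) p.val < 0 := fun i =>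
    mink_neg_of_mem_interior (hv i) (hPs.le.trans (iInter_subset _ i)) hp
  have hvol' : hVol n (⋂ i : s, hHalf n (v i)) < ⊤ := hPs ▸ hvol
  have hne : Nonempty s := by
    by_contra hne
    rw [not_nonempty_iff] at hne
    have j : Fin n := ⟨0, by omega⟩
    have := mink_self_nonpos_of_hVol_lt_top (x := EuclideanSpace.single j.succ 1)
      hn p.2 hps hvol' (fun i => hne.elim i)
    rw [mink_self] at this
    norm_num [Pi.single_apply, Fin.succ_inj] at this
  have hz : ∀ i : s, ∃ z : ↥(hypSet n), mink n (v i) z.val = 0 ∧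
      ∀ j : s, j ≠ i → mink n (v j) z.val < 0 := by
    intro i
    have hlt : s.erase i < s := Finset.erase_ssubset i.2
    have hnot := hs.not_prop_of_lt hlt
    have hsub : P ⊆ ⋂ j : s.erase i.1, hHalf n (v j) := fun x hx => mem_iInter.2 fun j => by
      rw [hPs] at hx
      exact mem_iInter.1 hx ⟨j, Finset.mem_of_mem_erase j.2⟩
    obtain ⟨y, hy, hyP⟩ := Set.not_subset.1 fun h => hnot (hsub.antisymm h)
    have hyj : ∀ j : s, j ≠ i → mink n (v j) y.val ≤ 0 := fun j hj =>
      mem_iInter.1 hy ⟨j, Finset.mem_erase.2 ⟨fun h => hj (Subtype.ext h), j.2⟩⟩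
    have hyi : 0 < mink n (v i) y.val := by
      by_contra! h
      refine hyP (hPs ▸ mem_iInter.2 fun j => ?_)
      by_cases hj : j = i
      · subst hj; exact h
      · exact hyj j hj
    have hr : 0 ≤ -mink n (v i) p.val / mink n (v i) y.val :=
      div_nonneg (by linarith [hps i]) hyi.le
    obtain ⟨t, ht, hmem⟩ := exists_smul_add_mem_hypSet p.2 (z := y.val)
      (by rw [y.2.1]; norm_num) y.2.2 hr
    refine ⟨⟨_, hmem⟩, ?_, fun j hj => ?_⟩
    · simp only [mink_smul_right, mink_add_right]
      field_simp; ring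
    · simp only [mink_smul_right, mink_add_right]
      exact mul_neg_of_pos_of_neg ht (add_neg_of_neg_of_nonpos (hps j)
        (mul_nonpos_of_nonneg_of_nonpos hr (hyj j hj)))
  have hsep : ∀ x, (∀ i : s, mink n (v i) x = 0) → x = 0 := by
    intro x hx
    have h1 := zero_nonneg_of_hVol_lt_top hn p.2 hps hvol' (x := x) fun i => (hx i).le
    have h2 := zero_nonneg_of_hVol_lt_top hn p.2 hps hvol' (x := -x) fun i => by
      rw [mink_neg_right, hx i, neg_zero]
    have h3 := mink_self_nonpos_of_hVol_lt_top hn p.2 hps hvol' (x := x) fun i => (hx i).le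
    exact eq_zero_of_mink_self_nonpos (le_antisymm (by simpa using h2) h1) h3
  set Φ : EuclideanSpace ℝ (Fin (n + 1)) →ₗ[ℝ] (s → ℝ) := LinearMap.pi fun i => minkL (v i) with hΦ
  have hΦa : ∀ x (i : s), Φ x i = mink n (v i) x := fun _ _ => rfl
  have hinj : Function.Injective Φ := by
    rw [← LinearMap.ker_eq_bot, LinearMap.ker_eq_bot']
    exact fun x hx => hsep x fun i => congrFun hx i
  have hle : n + 1 ≤ Fintype.card s := by
    simpa using LinearMap.finrank_le_finrank_of_injective hinj
  have hge : Fintype.card s ≤ n + 1 := by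
    have hfin : {S | hIsFacet n P S}.Finite := Set.finite_of_ncard_ne_zero (by omega)
    have hinj' : Function.Injective fun i : s => P ∩ hWall n (v i) := by
      intro i j hij
      by_contra hne
      obtain ⟨z, hzi, hzj⟩ := hz i
      have hmem : z ∈ P ∩ hWall n (v i) := by
        refine ⟨hPs ▸ mem_iInter.2 fun l => ?_, hzi⟩
        by_cases hl : l = i
        · subst hl; exact hzi.le
        · exact (hzj l hl).le
      have hij : P ∩ hWall n (v i) = P ∩ hWall n (v j) := hij
      rw [hij] at hmem
      exact (hzj j (Ne.symm hne)).ne hmem.2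
    rw [← hcard, ← Nat.card_eq_fintype_card, ← Set.ncard_univ,
      ← Set.ncard_image_of_injective _ hinj']
    refine Set.ncard_le_ncard ?_ hfin
    rintro _ ⟨i, -, rfl⟩
    obtain ⟨z, hzi, hzj⟩ := hz i
    exact hIsFacet_of_strict (e := fun i : s => v i) hPs (fun i => hv i) hzi hzj
  have hcardeq : Fintype.card s = n + 1 := le_antisymm hge hle
  have hsurj : Function.Surjective Φ :=
    (LinearMap.injective_iff_surjective_of_finrank_eq_finrank (by simp [← hcardeq])).1 hinj
  choose f hf using fun j : s => hsurj (-Pi.single j 1)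
  have hdual : ∀ i j : s, mink n (v i) (f j) = if i = j then -1 else 0 := by
    intro i j
    rw [← hΦa, hf, Pi.neg_apply, Pi.single_apply]
    split_ifs <;> simp
  have hcone : ∀ i j : s, mink n (v i) (f j) ≤ 0 := by
    intro i j
    rw [hdual]; split_ifs <;> norm_num
  have hcausal : ∀ j, mink n (f j) (f j) ≤ 0 := fun j =>
    mink_self_nonpos_of_hVol_lt_top hn p.2 hps hvol' fun i => hcone i j
  refine ⟨s, inferInstance, inferInstance, fun i => v i, f, hPs, hdual, hsep, hcausal,
    fun j => ?_, hcardeq, fun S hS => exists_eq_of_hIsFacet hPs (fun i => hv i) hS, fun i => hv i⟩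
  refine lt_of_le_of_ne (zero_nonneg_of_hVol_lt_top hn p.2 hps hvol' fun i => hcone i j)
    fun h0 => ?_
  have := hdual j j
  rw [eq_zero_of_mink_self_nonpos h0.symm (hcausal j), mink_zero_right] at this
  norm_num at this

/-! ### Frames and vertices -/

namespace IsFrame

variable {n : ℕ} {P : Set ↥(hypSet n)} {ι : Type*} [Fintype ι] [DecidableEq ι]
  {e f : ι → EuclideanSpace ℝ (Fin (n + 1))}

theorem expand_dual (h : IsFrame n P e f) (x : EuclideanSpace ℝ (Fin (n + 1))) :
    x = ∑ i, (-mink n (e i) x) • f i := by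
  refine sub_eq_zero.1 (h.separating _ fun i => ?_)
  rw [mink_sub_right, mink_sum_right]
  simp only [mink_smul_right, h.dual]
  simp

theorem expand (h : IsFrame n P e f) (x : EuclideanSpace ℝ (Fin (n + 1))) :
    x = ∑ i, (-mink n x (f i)) • e i := by
  refine sub_eq_zero.1 (mink_nondegenerate fun y => ?_)
  have hf : ∀ j, mink n (x - ∑ i, (-mink n x (f i)) • e i) (f j) = 0 := fun j => by
    rw [mink_sub_left, mink_sum_left]
    simp only [mink_smul_left, h.dual]
    simp
  rw [h.expand_dual y, mink_sum_right]
  simp only [mink_smul_right, hf, mul_zero, Finset.sum_const_zero]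

theorem dual_self (h : IsFrame n P e f) (i : ι) : mink n (e i) (f i) = -1 := by simp [h.dual]

theorem dual_ne (h : IsFrame n P e f) {i j : ι} (hij : i ≠ j) : mink n (e i) (f j) = 0 := by
  simp [h.dual, hij]

theorem mem_iff (h : IsFrame n P e f) {x : ↥(hypSet n)} :
    x ∈ P ↔ ∀ i, mink n (e i) x.val ≤ 0 := by
  rw [h.eq_iInter, mem_iInter_hHalf]

theorem eq_smul_dual (h : IsFrame n P e f) {x : EuclideanSpace ℝ (Fin (n + 1))} {a : ι}
    (hx : ∀ i, i ≠ a → mink n (e i) x = 0) : x = (-mink n (e a) x) • f a :=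
  (h.expand_dual x).trans (Finset.sum_eq_single a
    (fun i _ hi => by rw [hx i hi]; simp) (fun hn => absurd (Finset.mem_univ a) hn))

theorem exists_of_hIsVertex (h : IsFrame n P e f) (hn : 0 < n) {x : ↥(hypSet n)}
    (hx : hIsVertex n P x) :
    ∃ a, mink n (e a) x.val < 0 ∧ ∀ i, i ≠ a → mink n (e i) x.val = 0 := by
  classical
  obtain ⟨hxP, hcard⟩ := hx
  set A : Finset ι := Finset.univ.filter fun i => mink n (e i) x.val = 0 with hA
  have hle : n ≤ A.card := by
    refine hcard.trans ?_
    rw [← Set.ncard_coe_finset]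
    refine (Set.ncard_le_ncard ?_ (A.finite_toSet.image _)).trans
      (Set.ncard_image_le (f := fun i => P ∩ hWall n (e i)) A.finite_toSet)
    rintro S ⟨hS, hxS⟩
    obtain ⟨i, rfl⟩ := h.facet S hS
    have hi : mink n (e i) x.val = 0 := hxS.2
    exact ⟨i, by simpa [hA] using hi, rfl⟩
  obtain ⟨a, ha⟩ : ∃ a, mink n (e a) x.val ≠ 0 := by
    by_contra! hall
    have h0 := h.separating _ hall
    have := x.2.2
    rw [h0] at this
    exact lt_irrefl _ this
  refine ⟨a, lt_of_le_of_ne (h.mem_iff.1 hxP a) ha, fun i hi => ?_⟩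
  by_contra hne
  have hsub : A ⊆ (Finset.univ.erase a).erase i := fun j hj => by
    have hj0 : mink n (e j) x.val = 0 := by simpa [hA] using hj
    refine Finset.mem_erase.2 ⟨?_, Finset.mem_erase.2 ⟨?_, Finset.mem_univ _⟩⟩
    · rintro rfl; exact hne hj0
    · rintro rfl; exact ha hj0
  have := Finset.card_le_card hsub
  rw [Finset.card_erase_of_mem (Finset.mem_erase.2 ⟨hi, Finset.mem_univ _⟩),
    Finset.card_erase_of_mem (Finset.mem_univ _), Finset.card_univ, h.card_eq] at this
  omega

theorem eq_of_vertex_index_eq (h : IsFrame n P e f) {x y : ↥(hypSet n)} {a : ι}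
    (hx : ∀ i, i ≠ a → mink n (e i) x.val = 0) (hxa : mink n (e a) x.val < 0)
    (hy : ∀ i, i ≠ a → mink n (e i) y.val = 0) (hya : mink n (e a) y.val < 0) : y = x := by
  have hxf : x.val = (-mink n (e a) x.val) • f a := h.eq_smul_dual hx
  have hyf : y.val = (-mink n (e a) y.val) • f a := h.eq_smul_dual hy
  set α := -mink n (e a) x.val with hα
  set β := -mink n (e a) y.val with hβ
  have hxx := x.2.1
  have hyy := y.2.1
  rw [hxf, mink_smul_left, mink_smul_right] at hxx
  rw [hyf, mink_smul_left, mink_smul_right] at hyy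
  have hα0 : 0 < α := by linarith
  have hβ0 : 0 < β := by linarith
  have hff : mink n (f a) (f a) ≠ 0 := fun h0 => by rw [h0] at hxx; norm_num at hxx
  have hab : β ^ 2 = α ^ 2 := mul_right_cancel₀ hff (by linear_combination hyy - hxx)
  have hab : β = α := (pow_left_inj₀ hβ0.le hα0.le two_ne_zero).1 hab
  exact Subtype.ext (by rw [hyf, hxf, hab])

end IsFrame

/-- If near `x` an intersection of half-spaces is contained in a further half-space having `x`
on its boundary, then the same inclusion holds for the tangent cones. -/
theorem mink_nonpos_of_tangent {n : ℕ} {ι : Type*} [Finite ι]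
    {e : ι → EuclideanSpace ℝ (Fin (n + 1))} {u η : EuclideanSpace ℝ (Fin (n + 1))}
    {x : ↥(hypSet n)} {U : Set ↥(hypSet n)} (hU : U ∈ nhds x)
    (hsub : ∀ y ∈ U, (∀ i, mink n (e i) y.val ≤ 0) → mink n u y.val ≤ 0)
    (hx : ∀ i, mink n (e i) x.val ≤ 0) (hu : mink n u x.val = 0)
    (hη : ∀ i, mink n (e i) x.val = 0 → mink n (e i) η ≤ 0) : mink n u η ≤ 0 := by
  have hV : (⋂ i : {i // mink n (e i) x.val < 0}, {y : ↥(hypSet n) | mink n (e i) y.val < 0}) ∈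
      nhds x :=
    (isOpen_iInter_of_finite fun i : {i // mink n (e i) x.val < 0} =>
      isOpen_mink_neg (e i)).mem_nhds (mem_iInter.2 fun i => i.2)
  obtain ⟨ε, ⟨y, hy, s, hs, hys⟩, hε⟩ :=
    ((eventually_perturb x (Filter.inter_mem hU hV) η).and self_mem_nhdsWithin).exists
  have hε : 0 < ε := hε
  have h := hsub y hy.1 fun i => by
    rcases (hx i).lt_or_eq with h | h
    · have h' : mink n (e i) y.val < 0 := mem_iInter.1 hy.2 ⟨i, h⟩
      exact h'.le
    · rw [hys, mink_smul_right, mink_add_right, mink_smul_right, h, zero_add]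
      exact mul_nonpos_of_nonneg_of_nonpos hs.le (mul_nonpos_of_nonneg_of_nonpos hε.le (hη i h))
  rw [hys, mink_smul_right, mink_add_right, mink_smul_right, hu, zero_add] at h
  by_contra! hpos
  have := mul_pos hs (mul_pos hε hpos)
  linarith

namespace IsFrame

variable {n : ℕ} {P : Set ↥(hypSet n)} {ι : Type*} [Fintype ι] [DecidableEq ι]
  {e f : ι → EuclideanSpace ℝ (Fin (n + 1))} {κ : Type*} [Finite κ]
  {w : κ → EuclideanSpace ℝ (Fin (n + 1))}

/-- A polyhedron which coincides with a simplex near a point `x` has all the walls of the simplex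
through `x`. -/
theorem exists_eq_of_local_eq (h : IsFrame n P e f) (hw : ∀ j, mink n (w j) (w j) = 1)
    {x : ↥(hypSet n)} (hxw : ∀ j, mink n (w j) x.val ≤ 0) {U : Set ↥(hypSet n)} (hU : U ∈ nhds x)
    (hPT : ∀ y ∈ U, y ∈ P → ∀ j, mink n (w j) y.val ≤ 0)
    (hTP : ∀ t : ↥(hypSet n), (∀ j, mink n (w j) t.val ≤ 0) → t ∈ P) {i : ι}
    (hi : mink n (e i) x.val = 0) : ∃ j, w j = e i := by
  have hxP := h.mem_iff.1 (hTP x hxw)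
  have fwd : ∀ η, (∀ l, mink n (e l) η ≤ 0) → ∀ j, mink n (w j) x.val = 0 → mink n (w j) η ≤ 0 :=
    fun η hη j hj => mink_nonpos_of_tangent hU (fun y hy hye => hPT y hy (h.mem_iff.2 hye) j)
      hxP hj fun l _ => hη l
  have bwd : ∀ η, (∀ j, mink n (w j) x.val = 0 → mink n (w j) η ≤ 0) → mink n (e i) η ≤ 0 :=
    fun η hη => mink_nonpos_of_tangent Filter.univ_mem
      (fun y _ hyw => h.mem_iff.1 (hTP y hyw) i) hxw hi hη
  set η₀ : EuclideanSpace ℝ (Fin (n + 1)) := ∑ l ∈ Finset.univ.erase i, f l with hη₀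
  have hη₀e : ∀ l, mink n (e l) η₀ = if l = i then 0 else -1 := fun l => by
    rw [hη₀, mink_sum_right]
    simp only [h.dual, Finset.sum_ite_eq, Finset.mem_erase, Finset.mem_univ, and_true]
    split_ifs <;> simp_all
  obtain ⟨j, hjx, hj⟩ : ∃ j, mink n (w j) x.val = 0 ∧ 0 ≤ mink n (w j) η₀ := by
    by_contra! hcon
    have hev : ∀ᶠ ε in nhdsWithin (0 : ℝ) (Ioi 0), ∀ j, mink n (w j) x.val = 0 →
        mink n (w j) (η₀ - ε • f i) < 0 := by
      rw [Filter.eventually_all]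
      intro j
      by_cases hjx : mink n (w j) x.val = 0
      · have hc : Continuous fun ε : ℝ => mink n (w j) (η₀ - ε • f i) :=
          (continuous_mink (w j)).comp (by fun_prop)
        filter_upwards [nhdsWithin_le_nhds (hc.continuousAt.eventually_lt
          (continuousAt_const (x := (0 : ℝ)) (y := (0 : ℝ))) (by simpa using hcon j hjx))]
          with ε hε _ using hε
      · exact Filter.Eventually.of_forall fun _ h0 => absurd h0 hjx
    obtain ⟨ε, hε, hε0⟩ := (hev.and self_mem_nhdsWithin).exists
    have hε0 : 0 < ε := hε0
    have := bwd _ fun j hj => (hε j hj).le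
    rw [mink_sub_right, mink_smul_right, hη₀e, h.dual_self] at this
    simp only [if_true] at this
    linarith
  have h0 : mink n (w j) η₀ = 0 := by
    refine le_antisymm (fwd _ (fun l => ?_) j hjx) hj
    rw [hη₀e]; split_ifs <;> norm_num
  have hfk : ∀ l, l ≠ i → mink n (w j) (f l) = 0 := by
    intro l hl
    have h1 := fwd (η₀ + f l) (fun m => by
      rw [mink_add_right, hη₀e, h.dual]; split_ifs <;> norm_num) j hjx
    have h2 := fwd (η₀ - f l) (fun m => by
      rw [mink_sub_right, hη₀e, h.dual]
      split_ifs with h1 h2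
      · exact absurd (h2.symm.trans h1) hl
      all_goals norm_num) j hjx
    rw [mink_add_right, h0] at h1
    rw [mink_sub_right, h0] at h2
    linarith
  have hfi : mink n (w j) (f i) ≤ 0 := by
    have h1 := fwd (η₀ + f i) (fun m => by
      rw [mink_add_right, hη₀e, h.dual]; split_ifs <;> norm_num) j hjx
    rwa [mink_add_right, h0, zero_add] at h1
  have hexp : w j = (-mink n (w j) (f i)) • e i :=
    (h.expand (w j)).trans (Finset.sum_eq_single i
      (fun l _ hl => by rw [hfk l hl]; simp) (fun hn => absurd (Finset.mem_univ i) hn))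
  set c := -mink n (w j) (f i) with hc
  have hcc := hw j
  rw [hexp, mink_smul_left, mink_smul_right, h.unit] at hcc
  have hc1 : c = 1 := by nlinarith
  exact ⟨j, by rw [hexp, hc1, one_smul]⟩

/-- Follow the edge of the simplex `P` from the vertex `x` towards the (possibly ideal) vertex
`f c`. If this edge leaves the non-obtuse-angled polyhedron `T` with normals `w`, then at the exit
point `q` the whole of `T` is seen at angle at least `π / 2` from the direction of `f c`. -/
theorem exists_exit (h : IsFrame n P e f)
    (hcox : ∀ i j, hWall n (w i) ≠ hWall n (w j) →
      (∃ y : ↥(hypSet n), (∀ l, mink n (w l) y.val ≤ 0) ∧ mink n (w i) y.val = 0 ∧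
        mink n (w j) y.val = 0) → mink n (w i) (w j) ≤ 0)
    (hTP : ∀ t : ↥(hypSet n), (∀ j, mink n (w j) t.val ≤ 0) → t ∈ P)
    {x : ↥(hypSet n)} (hxw : ∀ j, mink n (w j) x.val ≤ 0) {a c : ι}
    (hxa : ∀ i, i ≠ a → mink n (e i) x.val = 0) (hex : ∀ i, i ≠ a → ∃ j, w j = e i)
    (hxa' : mink n (e a) x.val < 0) (hc : ∃ j, 0 < mink n (w j) (f c)) :
    ∃ q : ↥(hypSet n), (∀ j, mink n (w j) q.val ≤ 0) ∧
      (∃ s r : ℝ, 0 < s ∧ q.val = s • (x.val + r • f c)) ∧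
      ∀ t : ↥(hypSet n), (∀ j, mink n (w j) t.val ≤ 0) →
        mink n (f c) t.val + mink n (f c) q.val * mink n q.val t.val ≤ 0 := by
  classical
  have := Fintype.ofFinite κ
  set z := f c with hz
  obtain ⟨j, hjm, hmin⟩ := Finset.exists_min_image
    (Finset.univ.filter fun j => 0 < mink n (w j) z)
    (fun j => -mink n (w j) x.val / mink n (w j) z) (by
      obtain ⟨j, hj⟩ := hc
      exact ⟨j, by simpa using hj⟩)
  have hj : 0 < mink n (w j) z := by simpa using hjm
  set r := -mink n (w j) x.val / mink n (w j) z with hr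
  have hr0 : 0 ≤ r := div_nonneg (by linarith [hxw j]) hj.le
  obtain ⟨s, hs, hmem⟩ := exists_smul_add_mem_hypSet x.2 (h.causal c) (h.future c) hr0
  obtain ⟨q, hq⟩ : ∃ q : ↥(hypSet n), q.val = s • (x.val + r • z) := ⟨⟨_, hmem⟩, rfl⟩
  have hqm : ∀ v, mink n v q.val = s * (mink n v x.val + r * mink n v z) := fun v => by
    rw [hq, mink_smul_right, mink_add_right, mink_smul_right]
  have hqj : mink n (w j) q.val = 0 := by
    rw [hqm, hr]; field_simp; ring
  have hqw : ∀ l, mink n (w l) q.val ≤ 0 := by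
    intro l
    rw [hqm]
    refine mul_nonpos_of_nonneg_of_nonpos hs.le ?_
    rcases le_or_gt (mink n (w l) z) 0 with hl | hl
    · have := mul_nonpos_of_nonneg_of_nonpos hr0 hl
      linarith [hxw l]
    · have := hmin l (by simpa using hl)
      rw [le_div_iff₀ hl] at this
      linarith
  have hez : ∀ i, i ≠ c → mink n (e i) z = 0 := fun i hi => h.dual_ne hi
  have heq : ∀ i, i ≠ a → i ≠ c → mink n (e i) q.val = 0 := fun i ha hc => by
    rw [hqm, hxa i ha, hez i hc]; ring
  have hwe : ∀ i, i ≠ a → i ≠ c → mink n (e i) (w j) ≤ 0 := by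
    intro i hia hic
    obtain ⟨l, hl⟩ := hex i hia
    rw [← hl]
    refine hcox l j (fun hwall => ?_) ⟨q, hqw, by rw [hl, heq i hia hic], hqj⟩
    obtain ⟨s', hs', hmem'⟩ := exists_smul_add_mem_hypSet q.2 (h.causal c) (h.future c)
      (zero_le_one' ℝ)
    have hmemw : (⟨_, hmem'⟩ : ↥(hypSet n)) ∈ hWall n (w l) := by
      change mink n (w l) (s' • (q.val + (1 : ℝ) • z)) = 0
      rw [hl, mink_smul_right, mink_add_right, mink_smul_right, heq i hia hic, hez i hic]
      ring
    rw [hwall] at hmemw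
    change mink n (w j) (s' • (q.val + (1 : ℝ) • z)) = 0 at hmemw
    rw [mink_smul_right, mink_add_right, mink_smul_right, hqj] at hmemw
    have := mul_pos hs' hj
    linarith
  have hee : ∀ i k, i ≠ a → i ≠ c → k ≠ a → k ≠ c → i ≠ k → mink n (e i) (e k) ≤ 0 := by
    intro i k hia hic hka hkc hik
    obtain ⟨l, hl⟩ := hex i hia
    obtain ⟨m, hm⟩ := hex k hka
    rw [← hl, ← hm]
    refine hcox l m (fun hwall => ?_)
      ⟨q, hqw, by rw [hl, heq i hia hic], by rw [hm, heq k hka hkc]⟩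
    obtain ⟨s', hs', hmem'⟩ := exists_smul_add_mem_hypSet q.2 (h.causal k) (h.future k)
      (zero_le_one' ℝ)
    have hmemw : (⟨_, hmem'⟩ : ↥(hypSet n)) ∈ hWall n (w l) := by
      change mink n (w l) (s' • (q.val + (1 : ℝ) • f k)) = 0
      rw [hl, mink_smul_right, mink_add_right, mink_smul_right, heq i hia hic, h.dual_ne hik]
      ring
    rw [hwall] at hmemw
    change mink n (w m) (s' • (q.val + (1 : ℝ) • f k)) = 0 at hmemw
    rw [hm, mink_smul_right, mink_add_right, mink_smul_right, heq k hka hkc, h.dual_self] at hmemw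
    linarith
  set d := z + mink n z q.val • q.val with hd
  have hdm : ∀ v, mink n v d = mink n v z + mink n z q.val * mink n v q.val := fun v => by
    rw [hd, mink_add_right, mink_smul_right]
  have hqd : mink n q.val d = 0 := by
    rw [hdm, q.2.1, mink_comm q.val z]; ring
  have hwd : mink n (w j) d = mink n (w j) z := by rw [hdm, hqj]; ring
  have hd0 : d ≠ 0 := fun h0 => by
    rw [h0, mink_zero_right] at hwd; linarith
  have hdd := mink_self_pos_of_orthogonal q.2 hqd hd0
  set lam := mink n (w j) z / mink n d d with hlam
  have hlam0 : 0 < lam := div_pos hj hdd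
  set g := w j - lam • d with hg
  have hgm : ∀ v, mink n g v = mink n (w j) v - lam * mink n d v := fun v => by
    rw [hg, mink_sub_left, mink_smul_left]
  have hgq : mink n g q.val = 0 := by rw [hgm, hqj, mink_comm d, hqd]; ring
  have hgd : mink n g d = 0 := by rw [hgm, hwd, hlam]; field_simp; ring
  have hgz : mink n g z = 0 := by
    have := hdm g
    rw [hgd, hgq] at this; linarith
  have hgx : mink n g x.val = 0 := by
    have := hqm g
    rw [hgq, hgz] at this
    simpa [hs.ne'] using this.symm
  have hgfa : mink n g (f a) = 0 := by
    have hxf : x.val = (-mink n (e a) x.val) • f a := h.eq_smul_dual hxa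
    rw [hxf, mink_smul_right] at hgx
    exact (mul_eq_zero.1 hgx).resolve_left (by linarith)
  set μ : ι → ℝ := fun i => -mink n g (f i) with hμ
  have hμa : μ a = 0 := by simp [hμ, hgfa]
  have hμc : μ c = 0 := by simp [hμ, ← hz, hgz]
  have hgexp : g = ∑ i, μ i • e i := h.expand g
  have heg : ∀ i, i ≠ a → i ≠ c → mink n (e i) g ≤ 0 := fun i hia hic => by
    rw [mink_comm, hgm, mink_comm d, hdm, hez i hic, heq i hia hic, mink_comm]
    simpa using hwe i hia hic
  have hμ0 : ∀ i, μ i ≤ 0 := by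
    set gp := ∑ i, (μ i ⊔ 0) • e i with hgp
    set gn := ∑ i, (-μ i ⊔ 0) • e i with hgn
    have hsplit : g = gp - gn := by
      rw [hgexp, hgp, hgn, ← Finset.sum_sub_distrib]
      refine Finset.sum_congr rfl fun i _ => ?_
      rw [← sub_smul]
      congr 1
      rcases le_total 0 (μ i) with hi | hi
      · rw [max_eq_left hi, max_eq_right (by linarith)]; ring
      · rw [max_eq_right hi, max_eq_left (by linarith)]; ring
    have h1 : mink n gp g ≤ 0 := by
      rw [hgp, mink_sum_left]
      refine Finset.sum_nonpos fun i _ => ?_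
      rw [mink_smul_left]
      by_cases hia : i = a
      · rw [hia, hμa]; simp
      by_cases hic : i = c
      · rw [hic, hμc]; simp
      exact mul_nonpos_of_nonneg_of_nonpos (le_max_right _ _) (heg i hia hic)
    have h2 : mink n gp gn ≤ 0 := by
      rw [hgp, hgn, mink_sum_left]
      refine Finset.sum_nonpos fun i _ => ?_
      rw [mink_sum_right]
      refine Finset.sum_nonpos fun k _ => ?_
      rw [mink_smul_left, mink_smul_right, ← mul_assoc]
      by_cases hia : i = a
      · rw [hia, hμa]; simp
      by_cases hic : i = c
      · rw [hic, hμc]; simp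
      by_cases hka : k = a
      · rw [hka, hμa]; simp
      by_cases hkc : k = c
      · rw [hkc, hμc]; simp
      by_cases hik : i = k
      · subst hik
        rcases le_total 0 (μ i) with hi | hi
        · rw [max_eq_right (a := -μ i) (by linarith)]; simp
        · rw [max_eq_right hi]; simp
      exact mul_nonpos_of_nonneg_of_nonpos
        (mul_nonneg (le_max_right _ _) (le_max_right _ _)) (hee i k hia hic hka hkc hik)
    have h3 : mink n gp gp ≤ 0 := by
      rw [hsplit, mink_sub_right] at h1; linarith
    have h4 : mink n q.val gp = 0 := by
      rw [hgp, mink_sum_right]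
      refine Finset.sum_eq_zero fun i _ => ?_
      rw [mink_smul_right]
      by_cases hia : i = a
      · rw [hia, hμa]; simp
      by_cases hic : i = c
      · rw [hic, hμc]; simp
      rw [mink_comm, heq i hia hic, mul_zero]
    have h5 := eq_zero_of_orthogonal q.2 h4 h3
    intro i
    have h6 : mink n gp (f i) = -(μ i ⊔ 0) := by
      rw [hgp, mink_sum_left]
      simp [mink_smul_left, h.dual]
    rw [h5, mink_zero_left] at h6
    linarith [le_max_left (μ i) 0]
  refine ⟨q, hqw, ⟨s, r, hs, hq⟩, fun t ht => ?_⟩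
  have htP := h.mem_iff.1 (hTP t ht)
  have hgt : 0 ≤ mink n g t.val := by
    rw [hgexp, mink_sum_left]
    refine Finset.sum_nonneg fun i _ => ?_
    rw [mink_smul_left]
    exact mul_nonneg_of_nonpos_of_nonpos (hμ0 i) (htP i)
  have hdt : mink n d t.val ≤ 0 := by
    rw [hgm] at hgt
    have := ht j
    by_contra! hpos
    have := mul_pos hlam0 hpos
    linarith
  rwa [mink_comm, hdm, mink_comm t.val z, mink_comm t.val q.val] at hdt

end IsFrame

/-- A tile which is the only one containing `x` fills a neighbourhood of `x` in the union of
the tiles. -/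
theorem exists_nhds_inter_subset {X : Type*} [TopologicalSpace X] {𝒯 : Set (Set X)}
    (hfin : 𝒯.Finite) (hcl : ∀ T ∈ 𝒯, IsClosed T) {T : Set X} {x : X}
    (huniq : ∀ T' ∈ 𝒯, x ∈ T' → T' = T) : ∃ U ∈ nhds x, ∀ y ∈ U, y ∈ ⋃₀ 𝒯 → y ∈ T := by
  have hclosed : IsClosed (⋃₀ (𝒯 \ {T})) := by
    rw [sUnion_eq_biUnion]
    exact (hfin.subset sdiff_subset).isClosed_biUnion fun T' hT' => hcl T' hT'.1
  refine ⟨(⋃₀ (𝒯 \ {T}))ᶜ, hclosed.isOpen_compl.mem_nhds ?_, fun y hy hyP => ?_⟩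
  · rintro ⟨T', hT', hxT'⟩
    exact hT'.2 (huniq T' hT'.1 hxT')
  · obtain ⟨T', hT', hyT'⟩ := hyP
    by_cases h : T' = T
    · exact h ▸ hyT'
    · exact absurd ⟨T', ⟨hT', h⟩, hyT'⟩ hy

/-- A convex polyhedron without obtuse dihedral angles, contained in a simplex and coinciding with
it near two distinct vertices, is the whole simplex. -/
theorem IsFrame.subset_of_two_vertices {n : ℕ} {P : Set ↥(hypSet n)} {ι : Type*} [Fintype ι]
    [DecidableEq ι] {e f : ι → EuclideanSpace ℝ (Fin (n + 1))} {κ : Type*} [Finite κ]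
    {w : κ → EuclideanSpace ℝ (Fin (n + 1))} (h : IsFrame n P e f) (hn : 0 < n)
    (hw : ∀ j, mink n (w j) (w j) = 1)
    (hcox : ∀ i j, hWall n (w i) ≠ hWall n (w j) →
      (∃ y : ↥(hypSet n), (∀ l, mink n (w l) y.val ≤ 0) ∧ mink n (w i) y.val = 0 ∧
        mink n (w j) y.val = 0) → mink n (w i) (w j) ≤ 0)
    (hTP : ∀ t : ↥(hypSet n), (∀ j, mink n (w j) t.val ≤ 0) → t ∈ P)
    {x y : ↥(hypSet n)} (hx : hIsVertex n P x) (hy : hIsVertex n P y) (hxy : y ≠ x)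
    (hxw : ∀ j, mink n (w j) x.val ≤ 0) (hyw : ∀ j, mink n (w j) y.val ≤ 0)
    (hxU : ∃ U ∈ nhds x, ∀ t ∈ U, t ∈ P → ∀ j, mink n (w j) t.val ≤ 0)
    (hyU : ∃ U ∈ nhds y, ∀ t ∈ U, t ∈ P → ∀ j, mink n (w j) t.val ≤ 0) :
    ∀ t ∈ P, ∀ j, mink n (w j) t.val ≤ 0 := by
  obtain ⟨a, hxa, hx0⟩ := h.exists_of_hIsVertex hn hx
  obtain ⟨b, hyb, hy0⟩ := h.exists_of_hIsVertex hn hy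
  have hab : a ≠ b := by
    rintro rfl
    exact hxy (h.eq_of_vertex_index_eq hx0 hxa hy0 hyb)
  obtain ⟨U, hU, hPU⟩ := hxU
  obtain ⟨V, hV, hPV⟩ := hyU
  have hexx : ∀ i, i ≠ a → ∃ j, w j = e i := fun i hi =>
    h.exists_eq_of_local_eq hw hxw hU hPU hTP (hx0 i hi)
  have hexy : ∀ i, i ≠ b → ∃ j, w j = e i := fun i hi =>
    h.exists_eq_of_local_eq hw hyw hV hPV hTP (hy0 i hi)
  have hvert : ∀ (z : ↥(hypSet n)) (c : ι), mink n (e c) z.val < 0 →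
      (∀ i, i ≠ c → mink n (e i) z.val = 0) → (∀ j, mink n (w j) z.val ≤ 0) →
      ∀ j, mink n (w j) (f c) ≤ 0 := by
    intro z c hzc hz0 hzw j
    have hzf : z.val = (-mink n (e c) z.val) • f c := h.eq_smul_dual hz0
    have := hzw j
    rw [hzf, mink_smul_right] at this
    by_contra! hpos
    have := mul_pos (neg_pos.2 hzc) hpos
    linarith
  have hneg : ∀ c (q : ↥(hypSet n)), mink n (f c) q.val < 0 := fun c q => by
    rw [mink_comm]
    exact mink_neg_of_causal q.2 (h.causal c) (h.future c)
  have key : ∀ c j, mink n (w j) (f c) ≤ 0 := by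
    intro c
    by_cases hca : c = a
    · rw [hca]; exact hvert x a hxa hx0 hxw
    by_cases hcb : c = b
    · rw [hcb]; exact hvert y b hyb hy0 hyw
    by_contra! hc
    obtain ⟨q, hqw, ⟨s, r, hs, hq⟩, hqT⟩ := h.exists_exit hcox hTP hxw hx0 hexx hxa hc
    obtain ⟨q', hqw', ⟨s', r', hs', hq'⟩, hqT'⟩ := h.exists_exit hcox hTP hyw hy0 hexy hyb hc
    have h1 := hqT q' hqw'
    have h2 := hqT' q hqw
    have h3 := hneg c q
    have h4 := hneg c q'
    rw [mink_comm q'.val q.val] at h2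
    have hqq : q = q' := Subtype.ext <| eq_of_mink_ge q.2 q'.2 (by
      by_contra! hlt
      nlinarith [mul_pos (add_pos (neg_pos.2 h3) (neg_pos.2 h4)) (sub_pos.2 hlt)])
    have h5 : mink n (e a) q.val < 0 := by
      rw [hq, mink_smul_right, mink_add_right, mink_smul_right, h.dual_ne (Ne.symm hca)]
      have := mul_pos hs (neg_pos.2 hxa)
      linarith
    rw [hqq, hq', mink_smul_right, mink_add_right, mink_smul_right, h.dual_ne (Ne.symm hca),
      hy0 a hab] at h5
    simp at h5
  intro t ht j
  have htP := h.mem_iff.1 ht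
  rw [h.expand_dual t.val, mink_sum_right]
  refine Finset.sum_nonpos fun i _ => ?_
  rw [mink_smul_right]
  exact mul_nonpos_of_nonneg_of_nonpos (by linarith [htP i]) (key i j)

theorem hIsCoxPoly.isClosed {n : ℕ} {T : Set ↥(hypSet n)} (hT : hIsCoxPoly n T) : IsClosed T := by
  obtain ⟨k, w, -, rfl, -⟩ := hT
  exact isClosed_iInter fun j => isClosed_hHalf (w j)

/-- **(Lemma 4 of the paper.)** Let `P` be an `n`-dimensional hyperbolic simplex,
`n ≥ 3`, with a non-trivial Coxeter decomposition such that every vertex of `P`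
is contained in exactly one tile. Then the tile containing a vertex `v` of `P`
contains no other vertex of `P`. -/
theorem statement8 (n : ℕ) (hn : 3 ≤ n)
    (P : Set ↥(hypSet n)) (𝒯 : Set (Set ↥(hypSet n)))
    (hP : hIsSimplex n P) (hdec : hIsCoxDecomp n P 𝒯) (hnt : 1 < 𝒯.ncard)
    (hv : ∀ x, hIsVertex n P x → ∃! T, T ∈ 𝒯 ∧ x ∈ T) :
    ∀ x, hIsVertex n P x → ∀ T ∈ 𝒯, x ∈ T →
      ∀ y, hIsVertex n P y → y ∈ T → y = x := by
  intro x hx T hT hxT y hy hyT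
  by_contra hxy
  obtain ⟨hfin, -, hcoxpoly, hunion, hdisj, -⟩ := hdec
  obtain ⟨ι, _, _, e, f, h⟩ := exists_isFrame hn hP
  have hnear : ∀ z, hIsVertex n P z → z ∈ T → ∃ U ∈ nhds z, ∀ t ∈ U, t ∈ P → t ∈ T := by
    intro z hz hzT
    have := exists_nhds_inter_subset hfin (fun T' hT' => (hcoxpoly T' hT').isClosed)
      (T := T) (x := z) fun T' hT' hzT' => (hv z hz).unique ⟨hT', hzT'⟩ ⟨hT, hzT⟩
    rwa [hunion] at this
  obtain ⟨k, w, hw, hTw, -, -, hcos⟩ := hcoxpoly T hT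
  have hmem : ∀ t, t ∈ T ↔ ∀ j, mink n (w j) t.val ≤ 0 := fun t => by
    rw [hTw, mem_iInter_hHalf]
  have hPT : ∀ t ∈ P, t ∈ T := by
    simp only [hmem] at hnear
    intro t ht
    refine (hmem t).2 (h.subset_of_two_vertices (by omega) hw ?_ ?_ hx hy hxy ((hmem x).1 hxT)
      ((hmem y).1 hyT) (hnear x hx ((hmem x).1 hxT)) (hnear y hy ((hmem y).1 hyT)) t ht)
    · rintro i j hij ⟨z, hzT, hzi, hzj⟩
      obtain ⟨m, hm, hmij⟩ := hcos i j hij ⟨z, (hmem z).2 hzT, hzi, hzj⟩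
      rw [hmij, neg_nonpos]
      have hm' : (2 : ℝ) ≤ m := by exact_mod_cast hm
      refine Real.cos_nonneg_of_neg_pi_div_two_le_of_le ?_ ?_
      · have : 0 ≤ Real.pi / m := by positivity
        linarith [Real.pi_pos]
      · exact div_le_div_of_nonneg_left Real.pi_pos.le two_pos hm'
    · exact fun t ht => hunion ▸ mem_sUnion_of_mem ((hmem t).2 ht) hT
  obtain ⟨T', hT', hne⟩ := Set.exists_ne_of_one_lt_ncard hnt T
  have hsub : interior T' ⊆ interior T := interior_mono fun t ht =>
    hPT t (hunion ▸ mem_sUnion_of_mem ht hT')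
  obtain ⟨_, _, -, -, ⟨p, hp⟩, -⟩ := hcoxpoly T' hT'
  exact (hdisj T' hT' T hT hne).subset ⟨hp, hsub hp⟩

end CD
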